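/- For a fixed nonempty pruned tree T, the collection of payoff sets P ⊆ [T] such that the game (T, P) is universally unravelable is a σ-algebra on [T]. -/

import Mathlib

universe u

namespace GS

variable {A B C : Type u}

/-- A tree on `A`: a set of finite sequences closed under prefixes. -/
def IsTree (T : Set (List A)) : Prop := ∀ ⦃x y : List A⦄, x <+: y → y ∈ T → x ∈ T

/-- A tree is pruned if every node has a proper extension in the tree. -/
def IsPruned (T : Set (List A)) : Prop := ∀ x ∈ T, ∃ a : A, x ++ [a] ∈ T

/-- The body of a tree: infinite sequences all of whose finite prefixes lie in the tree. -/
def body (T : Set (List A)) : Set (ℕ → A) :=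
  {a | ∀ n : ℕ, (List.ofFn fun i : Fin n => a i) ∈ T}

/-- The product of the discrete topologies on `ℕ → A`. -/
def seqTop (A : Type u) : TopologicalSpace (ℕ → A) :=
  @Pi.topologicalSpace ℕ (fun _ => A) (fun _ => ⊥)

/-- The subspace topology on the body of a tree. -/
def bodyTop (T : Set (List A)) : TopologicalSpace {a // a ∈ body T} :=
  TopologicalSpace.induced Subtype.val (seqTop A)

/-- A (functional) strategy for player `i` on the tree `T`: to each position of player `i`
(i.e. of length `≡ i (mod 2)`) in `T` it assigns a legal move. -/
structure Strategy (T : Set (List A)) (i : ℕ) where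
  move : List A → A
  legal : ∀ x ∈ T, x.length % 2 = i % 2 → x ++ [move x] ∈ T

/-- A play is consistent with a strategy of player `i` if all moves of player `i` are
given by the strategy. -/
def Consistent {T : Set (List A)} {i : ℕ} (σ : Strategy T i) (a : ℕ → A) : Prop :=
  ∀ n : ℕ, n % 2 = i % 2 → a n = σ.move (List.ofFn fun j : Fin n => a j)

/-- The plays (branches of the tree) consistent with a strategy; this is the body `[σ]`
of the strategy tree of `σ`. -/
def plays {T : Set (List A)} {i : ℕ} (σ : Strategy T i) : Set (ℕ → A) :=
  {a ∈ body T | Consistent σ a}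

/-- A strategy of player `i` is winning in the game `(T, P)` if every play consistent with it
is won by player `i`. -/
def WinningStrategy (T : Set (List A)) (P : Set (ℕ → A)) {i : ℕ} (σ : Strategy T i) : Prop :=
  ∀ a ∈ plays σ, if i % 2 = 0 then a ∈ P else a ∉ P

/-- A game is determined if one of the two players has a winning strategy. -/
def Determined (T : Set (List A)) (P : Set (ℕ → A)) : Prop :=
  (∃ σ : Strategy T 0, WinningStrategy T P σ) ∨ ∃ σ : Strategy T 1, WinningStrategy T P σ

/-- The strategy tree of a functional strategy: all positions reachable while player `i`
follows `σ`. -/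
def stratTree (T : Set (List A)) (i : ℕ) (σ : Strategy T i) : Set (List A) :=
  {x ∈ T | ∀ (y : List A) (a : A), y ++ [a] <+: x → y.length % 2 = i % 2 → a = σ.move y}

/-- A morphism of trees: an isotone, length-preserving map. -/
structure TreeHom (S : Set (List A)) (T : Set (List B)) where
  toFun : List A → List B
  mem : ∀ x ∈ S, toFun x ∈ T
  len : ∀ x ∈ S, (toFun x).length = x.length
  mono : ∀ ⦃x y : List A⦄, x ∈ S → y ∈ S → x <+: y → toFun x <+: toFun y

/-- The identity tree morphism. -/
def TreeHom.id (S : Set (List A)) : TreeHom S S where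
  toFun := _root_.id
  mem _ hx := hx
  len _ _ := rfl
  mono _ _ _ _ h := h

/-- Composition of tree morphisms. -/
def TreeHom.comp {S : Set (List A)} {T : Set (List B)} {U : Set (List C)}
    (g : TreeHom T U) (f : TreeHom S T) : TreeHom S U where
  toFun := g.toFun ∘ f.toFun
  mem x hx := g.mem _ (f.mem x hx)
  len x hx := by simp only [Function.comp_apply, g.len _ (f.mem x hx), f.len x hx]
  mono x y hx hy hxy := g.mono (f.mem x hx) (f.mem y hy) (f.mono hx hy hxy)

/-- The map induced on infinite branches by a length-preserving isotone map of trees. -/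
def bodyMap [Inhabited B] (f : List A → List B) (a : ℕ → A) : ℕ → B :=
  fun n => (f (List.ofFn fun i : Fin (n + 1) => a i)).getD n default

/-- A covering of trees: a tree morphism `π` together with a map `φ` of strategies (of either
player) satisfying the locality condition and the branch lifting condition. -/
structure Covering [Inhabited A] (S : Set (List B)) (T : Set (List A)) where
  π : TreeHom S T
  φ : ∀ i : ℕ, Strategy S i → Strategy T i
  agree : ∀ (i n : ℕ) (σ σ' : Strategy S i),
    (∀ x ∈ S, x.length ≤ n → σ.move x = σ'.move x) →
    ∀ x ∈ T, x.length ≤ n → (φ i σ).move x = (φ i σ').move x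
  lift : ∀ (i : ℕ) (σ : Strategy S i), ∀ a ∈ plays (φ i σ),
    ∃ a' ∈ plays σ, bodyMap π.toFun a' = a

/-- A covering is `k`-fixing if `π` restricts to a bijection on the first `k` levels and `φ` is
induced by `π` there. -/
structure IsFixing [Inhabited A] {S : Set (List B)} {T : Set (List A)} (k : ℕ)
    (c : Covering S T) : Prop where
  bij : Function.Bijective fun x : {x : List B // x ∈ S ∧ x.length ≤ k} =>
    (⟨c.π.toFun x.1, c.π.mem _ x.2.1, by rw [c.π.len _ x.2.1]; exact x.2.2⟩ :
      {x : List A // x ∈ T ∧ x.length ≤ k})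
  induced : ∀ (i : ℕ) (σ : Strategy S i), ∀ x ∈ S, x.length < k → x.length % 2 = i % 2 →
    c.π.toFun (x ++ [σ.move x]) = c.π.toFun x ++ [(c.φ i σ).move (c.π.toFun x)]

/-- A game `(T, P)` is unravelable if for every `k` there is a `k`-fixing covering of `T` such
that the preimage of `P` is clopen in the body of the covering tree. -/
def Unravelable [Inhabited A] (T : Set (List A)) (P : Set (ℕ → A)) : Prop :=
  ∀ k : ℕ, ∃ (B : Type u) (S : Set (List B)) (c : Covering S T),
    IsTree S ∧ IsPruned S ∧ S.Nonempty ∧ IsFixing k c ∧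
    @IsClopen _ (bodyTop S) {a : {a // a ∈ body S} | bodyMap c.π.toFun a.1 ∈ P}

/-- A game `(T, P)` is universally unravelable if for every covering of `T` the game with the
preimage of `P` as payoff set is unravelable. -/
def UnivUnravelable [Inhabited A] (T : Set (List A)) (P : Set (ℕ → A)) : Prop :=
  ∀ (B : Type u) (_ : Inhabited B) (S : Set (List B)) (c : Covering S T),
    IsTree S → IsPruned S → S.Nonempty →
    Unravelable S (bodyMap c.π.toFun ⁻¹' P)

end GS

namespace GS

section Basics

variable {A B C : Type u}

/-- The initial segment of length `n` of an infinite sequence. -/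
def pre (a : ℕ → A) (n : ℕ) : List A := List.ofFn fun i : Fin n => a i

@[simp] theorem length_pre (a : ℕ → A) (n : ℕ) : (pre a n).length = n := by simp [pre]

@[simp] theorem pre_zero (a : ℕ → A) : pre a 0 = [] := by simp [pre]

theorem pre_succ (a : ℕ → A) (n : ℕ) : pre a (n + 1) = pre a n ++ [a n] := by
  rw [pre, List.ofFn_succ_last]
  rfl

theorem pre_prefix_pre (a : ℕ → A) {m n : ℕ} (h : m ≤ n) : pre a m <+: pre a n := by
  induction n, h using Nat.le_induction with
  | base => exact List.prefix_rfl
  | succ n _ ih => exact ih.trans (by rw [pre_succ]; exact List.prefix_append _ _)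

theorem eq_of_prefix_of_prefix {x y z : List A} (hx : x <+: z) (hy : y <+: z)
    (h : x.length = y.length) : x = y := by
  rw [List.prefix_iff_eq_take.1 hx, List.prefix_iff_eq_take.1 hy, h]

theorem eq_pre_of_prefix {a : ℕ → A} {n : ℕ} {x : List A} (h : x <+: pre a n) :
    x = pre a x.length :=
  eq_of_prefix_of_prefix h (pre_prefix_pre a (by simpa using h.length_le)) (by simp)

theorem take_pre (a : ℕ → A) {m n : ℕ} (h : m ≤ n) : (pre a n).take m = pre a m :=
  eq_of_prefix_of_prefix (List.take_prefix _ _) (pre_prefix_pre a h) (by simp [h])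

theorem pre_injective {a b : ℕ → A} (h : ∀ n, pre a n = pre b n) : a = b := by
  funext n
  have := h (n + 1)
  rw [pre_succ, pre_succ, h n] at this
  simpa using this

theorem pre_mem {T : Set (List A)} {a : ℕ → A} (ha : a ∈ body T) (n : ℕ) : pre a n ∈ T := ha n

theorem exists_append_of_prefix {x y : List A} (h : x <+: y) (hl : y.length = x.length + 1) :
    ∃ a, y = x ++ [a] := by
  obtain ⟨t, rfl⟩ := h
  rw [List.length_append] at hl
  obtain ⟨a, rfl⟩ := List.length_eq_one_iff.1 (show t.length = 1 by omega)
  exact ⟨a, rfl⟩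

theorem append_singleton_prefix {x y : List A} (h : x <+: y) (hl : x.length < y.length) :
    ∃ a, x ++ [a] <+: y := by
  obtain ⟨t, rfl⟩ := h
  cases t with
  | nil => simp at hl
  | cons a t => exact ⟨a, t, by simp⟩

theorem TreeHom.exists_append {S : Set (List A)} {T : Set (List B)} (f : TreeHom S T)
    {x : List A} {a : A} (hx : x ∈ S) (hxa : x ++ [a] ∈ S) :
    ∃ b, f.toFun (x ++ [a]) = f.toFun x ++ [b] :=
  exists_append_of_prefix (f.mono hx hxa (List.prefix_append _ _))
    (by rw [f.len _ hx, f.len _ hxa]; simp)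

theorem TreeHom.toFun_pre [Inhabited B] {S : Set (List A)} {T : Set (List B)} (f : TreeHom S T)
    {a : ℕ → A} (ha : a ∈ body S) (n : ℕ) : f.toFun (pre a n) = pre (bodyMap f.toFun a) n := by
  induction n with
  | zero => simpa using f.len _ (pre_mem ha 0)
  | succ n ih =>
    have h1 := pre_mem ha (n + 1)
    rw [pre_succ] at h1
    obtain ⟨b, hb⟩ := f.exists_append (pre_mem ha n) h1
    have hl := f.len _ (pre_mem ha n)
    have hval : bodyMap f.toFun a n = b := by
      change (f.toFun (pre a (n + 1))).getD n default = b
      rw [pre_succ, hb]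
      rw [length_pre] at hl
      simp [hl]
    rw [pre_succ, hb, ih, pre_succ, hval]

theorem TreeHom.bodyMap_mem [Inhabited B] {S : Set (List A)} {T : Set (List B)} (f : TreeHom S T)
    {a : ℕ → A} (ha : a ∈ body S) : bodyMap f.toFun a ∈ body T := fun n => by
  change pre (bodyMap f.toFun a) n ∈ T
  rw [← f.toFun_pre ha]
  exact f.mem _ (pre_mem ha n)

theorem TreeHom.bodyMap_eq [Inhabited B] {S : Set (List A)} {T : Set (List B)} (f : TreeHom S T)
    {a : ℕ → A} (ha : a ∈ body S) {b : ℕ → B} (h : ∀ n, f.toFun (pre a n) = pre b n) :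
    bodyMap f.toFun a = b :=
  pre_injective fun n => by rw [← f.toFun_pre ha, h]

theorem TreeHom.bodyMap_comp [Inhabited B] [Inhabited C] {S : Set (List A)} {T : Set (List B)}
    {U : Set (List C)} (g : TreeHom T U) (f : TreeHom S T) {a : ℕ → A} (ha : a ∈ body S) :
    bodyMap (g.comp f).toFun a = bodyMap g.toFun (bodyMap f.toFun a) :=
  (g.comp f).bodyMap_eq ha fun n => by
    rw [← g.toFun_pre (f.bodyMap_mem ha), ← f.toFun_pre ha]
    rfl

/-- Composition of coverings. -/
def Covering.comp [Inhabited A] [Inhabited B] {S : Set (List C)} {T : Set (List B)}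
    {U : Set (List A)} (d : Covering T U) (c : Covering S T) : Covering S U where
  π := d.π.comp c.π
  φ i σ := d.φ i (c.φ i σ)
  agree i n σ σ' h := d.agree i n _ _ (c.agree i n σ σ' h)
  lift i σ a ha := by
    obtain ⟨b, hb, rfl⟩ := d.lift i _ a ha
    obtain ⟨a', ha', rfl⟩ := c.lift i _ b hb
    exact ⟨a', ha', TreeHom.bodyMap_comp _ _ ha'.1⟩

theorem IsFixing.comp [Inhabited A] [Inhabited B] {S : Set (List C)} {T : Set (List B)}
    {U : Set (List A)} {d : Covering T U} {c : Covering S T} {k : ℕ} (hd : IsFixing k d)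
    (hc : IsFixing k c) : IsFixing k (d.comp c) where
  bij := hd.bij.comp hc.bij
  induced i σ x hx hk hi := by
    change d.π.toFun (c.π.toFun _) = d.π.toFun (c.π.toFun x) ++ _
    have hl := c.π.len x hx
    rw [hc.induced i σ x hx hk hi, hd.induced i _ _ (c.π.mem x hx) (hl ▸ hk) (hl ▸ hi)]
    rfl

theorem IsFixing.injective [Inhabited A] {S : Set (List B)} {T : Set (List A)} {k : ℕ}
    {c : Covering S T} (hc : IsFixing k c) {x y : List B} (hx : x ∈ S) (hy : y ∈ S)
    (hxk : x.length ≤ k) (h : c.π.toFun x = c.π.toFun y) : x = y := by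
  have hyk : y.length ≤ k := by rw [← c.π.len y hy, ← h, c.π.len x hx]; exact hxk
  have := @hc.bij.1 ⟨x, hx, hxk⟩ ⟨y, hy, hyk⟩ (Subtype.ext h)
  exact congrArg Subtype.val this

theorem IsFixing.surjective [Inhabited A] {S : Set (List B)} {T : Set (List A)} {k : ℕ}
    {c : Covering S T} (hc : IsFixing k c) {y : List A} (hy : y ∈ T)
    (hyk : y.length ≤ k) : ∃ x ∈ S, c.π.toFun x = y := by
  obtain ⟨⟨x, hx, _⟩, h⟩ := hc.bij.2 ⟨y, hy, hyk⟩
  exact ⟨x, hx, congrArg Subtype.val h⟩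

theorem isFixing_of_bijOn [Inhabited A] {S : Set (List B)} {T : Set (List A)} {k : ℕ}
    {c : Covering S T}
    (hinj : ∀ x ∈ S, ∀ y ∈ S, x.length ≤ k → c.π.toFun x = c.π.toFun y → x = y)
    (hsurj : ∀ y ∈ T, y.length ≤ k → ∃ x ∈ S, c.π.toFun x = y)
    (hind : ∀ (i : ℕ) (σ : Strategy S i), ∀ x ∈ S, x.length < k → x.length % 2 = i % 2 →
      c.π.toFun (x ++ [σ.move x]) = c.π.toFun x ++ [(c.φ i σ).move (c.π.toFun x)]) :
    IsFixing k c where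
  bij := by
    refine ⟨?_, ?_⟩
    · rintro ⟨x, hx, hxk⟩ ⟨y, hy, hyk⟩ h
      exact Subtype.ext (hinj x hx y hy hxk (congrArg Subtype.val h))
    · rintro ⟨y, hy, hyk⟩
      obtain ⟨x, hx, rfl⟩ := hsurj y hy hyk
      exact ⟨⟨x, hx, by rwa [c.π.len x hx] at hyk⟩, rfl⟩
  induced := hind

theorem IsFixing.mono [Inhabited A] {S : Set (List B)} {T : Set (List A)} {k l : ℕ}
    {c : Covering S T} (hc : IsFixing l c) (h : k ≤ l) : IsFixing k c :=
  isFixing_of_bijOn (fun _ hx _ hy hxk => hc.injective hx hy (hxk.trans h))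
    (fun _ hy hyk => hc.surjective hy (hyk.trans h))
    (fun i σ x hx hxk => hc.induced i σ x hx (hxk.trans_le h))

/-- The identity covering. -/
def Covering.id [Inhabited A] (T : Set (List A)) : Covering T T where
  π := TreeHom.id T
  φ _ σ := σ
  agree _ _ _ _ h := h
  lift _ _ a ha := ⟨a, ha, (TreeHom.id T).bodyMap_eq ha.1 fun _ => rfl⟩

theorem isFixing_id [Inhabited A] (T : Set (List A)) (k : ℕ) : IsFixing k (Covering.id T) :=
  isFixing_of_bijOn (fun _ _ _ _ _ h => h) (fun y hy _ => ⟨y, hy, rfl⟩)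
    (fun _ _ _ _ _ _ => rfl)

theorem isOpen_bodyTop_iff {T : Set (List A)} {V : Set {a // a ∈ body T}} :
    @IsOpen _ (bodyTop T) V ↔
      ∀ a ∈ V, ∃ n, ∀ b : {a // a ∈ body T}, pre b.1 n = pre a.1 n → b ∈ V := by
  let tA : TopologicalSpace A := ⊥
  have : DiscreteTopology A := ⟨rfl⟩
  constructor
  · intro hV a ha
    obtain ⟨W, hW, rfl⟩ := isOpen_induced_iff.1 hV
    obtain ⟨I, u, hu, hsub⟩ := isOpen_pi_iff.1 hW a.1 ha
    refine ⟨I.sup _root_.id + 1, fun b hb => hsub fun j hj => ?_⟩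
    have hj' : j + 1 ≤ I.sup _root_.id + 1 := Nat.succ_le_succ (Finset.le_sup (f := _root_.id) hj)
    have h1 : pre b.1 (j + 1) = pre a.1 (j + 1) := by
      rw [← take_pre b.1 hj', hb, take_pre a.1 hj']
    have h2 : b.1 j = a.1 j := by
      rw [pre_succ, pre_succ] at h1
      simpa using (List.append_inj' h1 rfl).2
    rw [h2]
    exact (hu j hj).2
  · intro h
    refine isOpen_induced_iff.2 ⟨{b | ∃ a ∈ V, ∃ n, pre b n = pre a.1 n ∧
      ∀ b : {a // a ∈ body T}, pre b.1 n = pre a.1 n → b ∈ V}, ?_, ?_⟩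
    · change IsOpen (X := ℕ → A) _
      rw [isOpen_pi_iff]
      rintro b ⟨a, ha, n, hb, hn⟩
      refine ⟨Finset.range n, fun j => {b j}, fun j _ => ⟨isOpen_discrete _, rfl⟩, ?_⟩
      intro b' hb'
      refine ⟨a, ha, n, ?_, hn⟩
      rw [← hb]
      refine congrArg List.ofFn (funext fun i => ?_)
      exact hb' i.1 (by simp)
    · ext b
      constructor
      · rintro ⟨a, _, n, hb, hn⟩
        exact hn b hb
      · intro hb
        obtain ⟨n, hn⟩ := h b hb
        exact ⟨b, hb, n, rfl, hn⟩

theorem isClopen_bodyTop_of_determined {T : Set (List A)} {V : Set {a // a ∈ body T}} (n : ℕ)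
    (h : ∀ a b : {a // a ∈ body T}, pre a.1 n = pre b.1 n → a ∈ V → b ∈ V) :
    @IsClopen _ (bodyTop T) V := by
  let := bodyTop T
  refine ⟨⟨?_⟩, ?_⟩
  · exact isOpen_bodyTop_iff.2 fun a ha => ⟨n, fun b hb hbV => ha (h b a hb hbV)⟩
  · exact isOpen_bodyTop_iff.2 fun a ha => ⟨n, fun b hb => h a b hb.symm ha⟩

theorem continuous_bodyMap [Inhabited B] {S : Set (List A)} {T : Set (List B)} (f : TreeHom S T) :
    @Continuous _ _ (bodyTop S) (bodyTop T)
      fun a : {a // a ∈ body S} => ⟨bodyMap f.toFun a.1, f.bodyMap_mem a.2⟩ := by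
  let := bodyTop S
  let := bodyTop T
  refine ⟨fun V hV => isOpen_bodyTop_iff.2 fun a ha => ?_⟩
  obtain ⟨n, hn⟩ := isOpen_bodyTop_iff.1 hV _ ha
  refine ⟨n, fun b hb => hn _ ?_⟩
  change pre (bodyMap f.toFun b.1) n = pre (bodyMap f.toFun a.1) n
  rw [← f.toFun_pre b.2, hb, f.toFun_pre a.2]

open Classical in
/-- A strategy playing the candidate moves `m` whenever these are legal. -/
noncomputable def Strategy.ofMoves {T : Set (List A)} (hT : IsPruned T) (i : ℕ)
    (m : List A → A) : Strategy T i where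
  move x := if x ++ [m x] ∈ T then m x else if h : x ∈ T then (hT x h).choose else m x
  legal x hx _ := by
    split_ifs with h
    · exact h
    · exact (hT x hx).choose_spec

theorem Strategy.ofMoves_move {T : Set (List A)} (hT : IsPruned T) (i : ℕ) {m : List A → A}
    {x : List A} (h : x ++ [m x] ∈ T) : (Strategy.ofMoves hT i m).move x = m x := by
  simp [Strategy.ofMoves, h]

theorem Strategy.ofMoves_congr {T : Set (List A)} (hT : IsPruned T) (i : ℕ) {m m' : List A → A}
    {x : List A} (h : m x = m' x) :
    (Strategy.ofMoves hT i m).move x = (Strategy.ofMoves hT i m').move x := by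
  simp only [Strategy.ofMoves]
  rw [h]

theorem Strategy.eq_of_plays {T : Set (List A)} {i : ℕ} {σ : Strategy T i} {a : ℕ → A}
    (ha : a ∈ plays σ) {n : ℕ} (hn : n % 2 = i % 2) : a n = σ.move (pre a n) :=
  ha.2 n hn

theorem exists_move {T : Set (List A)} (hT : IsPruned T) (hne : T.Nonempty) : Nonempty A := by
  obtain ⟨x, hx⟩ := hne
  exact ⟨(hT x hx).choose⟩

end Basics

section Normalize

variable {A B : Type u}

/-- The strategy with the moves at the positions of the opponent replaced by a default value. -/
noncomputable def Strategy.normalize [Inhabited A] {T : Set (List A)} {i : ℕ} (σ : Strategy T i) :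
    Strategy T i where
  move x := if x.length % 2 = i % 2 then σ.move x else default
  legal x hx hi := by rw [if_pos hi]; exact σ.legal x hx hi

theorem Strategy.normalize_move [Inhabited A] {T : Set (List A)} {i : ℕ} (σ : Strategy T i)
    {x : List A} (h : x.length % 2 = i % 2) : σ.normalize.move x = σ.move x := if_pos h

theorem Strategy.mem_plays_normalize [Inhabited A] {T : Set (List A)} {i : ℕ} (σ : Strategy T i)
    {a : ℕ → A} : a ∈ plays σ.normalize ↔ a ∈ plays σ := by
  refine and_congr_right fun _ => forall₂_congr fun n hn => ?_
  rw [σ.normalize_move (by simpa using hn)]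

/-- Two strategies agree at the positions of their player in `T` of length at most `n`. -/
def AgreeUpTo {T : Set (List A)} {i : ℕ} (n : ℕ) (σ σ' : Strategy T i) : Prop :=
  ∀ x ∈ T, x.length % 2 = i % 2 → x.length ≤ n → σ.move x = σ'.move x

/-- The strategy map of a covering, made independent of the moves at the positions of the
opponent. -/
noncomputable def Covering.strat [Inhabited A] [Inhabited B] {S : Set (List B)} {T : Set (List A)}
    (c : Covering S T) {i : ℕ} (σ : Strategy S i) : Strategy T i := c.φ i σ.normalize

theorem Covering.strat_agree [Inhabited A] [Inhabited B] {S : Set (List B)} {T : Set (List A)}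
    (c : Covering S T) {i n : ℕ} {σ σ' : Strategy S i} (h : AgreeUpTo n σ σ') :
    AgreeUpTo n (c.strat σ) (c.strat σ') := fun x hx _ hn =>
  c.agree i n σ.normalize σ'.normalize (fun y hy hyn => by
    by_cases hi : y.length % 2 = i % 2
    · rw [σ.normalize_move hi, σ'.normalize_move hi, h y hy hi hyn]
    · simp [Strategy.normalize, hi]) x hx hn

theorem Covering.strat_lift [Inhabited A] [Inhabited B] {S : Set (List B)} {T : Set (List A)}
    (c : Covering S T) {i : ℕ} (σ : Strategy S i) {a : ℕ → A} (ha : a ∈ plays (c.strat σ)) :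
    ∃ a' ∈ plays σ, bodyMap c.π.toFun a' = a := by
  obtain ⟨a', ha', h⟩ := c.lift i _ a ha
  exact ⟨a', σ.mem_plays_normalize.1 ha', h⟩

theorem IsFixing.strat_induced [Inhabited A] [Inhabited B] {S : Set (List B)} {T : Set (List A)}
    {c : Covering S T} {k : ℕ} (hc : IsFixing k c) {i : ℕ} (σ : Strategy S i) {x : List B}
    (hx : x ∈ S) (hk : x.length < k) (hi : x.length % 2 = i % 2) :
    c.π.toFun (x ++ [σ.move x]) = c.π.toFun x ++ [(c.strat σ).move (c.π.toFun x)] := by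
  have h := hc.induced i σ.normalize x hx hk hi
  rwa [σ.normalize_move hi] at h

end Normalize

section Limit

variable {B : ℕ → Type u} {S : ∀ n, Set (List (B n))}

/-- The component at stage `n` of a finite sequence in a product. -/
def proj (n : ℕ) (x : List (∀ n, B n)) : List (B n) := x.map (· n)

@[simp] theorem length_proj (n : ℕ) (x : List (∀ n, B n)) : (proj n x).length = x.length := by
  simp [proj]

theorem proj_append (n : ℕ) (x : List (∀ n, B n)) (b : ∀ n, B n) :
    proj n (x ++ [b]) = proj n x ++ [b n] := by
  simp [proj]

theorem proj_ext {x y : List (∀ n, B n)} (h : ∀ n, proj n x = proj n y) : x = y := by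
  have hl : x.length = y.length := by rw [← length_proj 0 x, h, length_proj]
  refine List.ext_getElem hl fun j hj hj' => funext fun n => ?_
  have h1 : (proj n x)[j]'(by simpa using hj) = (proj n y)[j]'(by simpa using hj') := by
    simp only [h n]
  simpa [proj] using h1

theorem exists_proj_eq {l : ℕ} (y : ∀ n, List (B n)) (hy : ∀ n, (y n).length = l) :
    ∃ x : List (∀ n, B n), ∀ n, proj n x = y n := by
  refine ⟨List.ofFn fun (j : Fin l) n => (y n)[j.1]'(by rw [hy]; exact j.2), fun n => ?_⟩
  refine List.ext_getElem (by simp [hy]) fun j hj hj' => ?_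
  simp [proj]

theorem proj_pre (a : ℕ → ∀ n, B n) (n l : ℕ) : proj n (pre a l) = pre (fun j => a j n) l := by
  simp [proj, pre, List.map_ofFn, Function.comp_def]

/-- The inverse limit of a sequence of trees. -/
def limTree (π : ∀ n, TreeHom (S (n + 1)) (S n)) : Set (List (∀ n, B n)) :=
  {x | ∀ n, proj n x ∈ S n ∧ (π n).toFun (proj (n + 1) x) = proj n x}

/-- The projection of the inverse limit to stage `n`. -/
def limHom (π : ∀ n, TreeHom (S (n + 1)) (S n)) (n : ℕ) : TreeHom (limTree π) (S n) where
  toFun := proj n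
  mem _ hx := (hx n).1
  len _ _ := length_proj n _
  mono _ _ _ _ h := h.map _

theorem isTree_limTree {π : ∀ n, TreeHom (S (n + 1)) (S n)} (hS : ∀ n, IsTree (S n)) :
    IsTree (limTree π) := fun x y hxy hy n => by
  have hx : ∀ n, proj n x ∈ S n := fun n => hS n (hxy.map _) (hy n).1
  refine ⟨hx n, eq_of_prefix_of_prefix (z := proj n y) ?_ (hxy.map _) ?_⟩
  · rw [← (hy n).2]
    exact (π n).mono (hx _) (hy _).1 (hxy.map _)
  · rw [(π n).len _ (hx _)]
    simp

theorem nonempty_limTree {π : ∀ n, TreeHom (S (n + 1)) (S n)} (hS : ∀ n, IsTree (S n))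
    (hne : ∀ n, (S n).Nonempty) : (limTree π).Nonempty := by
  have h : ∀ n, [] ∈ S n := fun n => hS n List.nil_prefix (hne n).choose_spec
  exact ⟨[], fun n => ⟨h n, List.length_eq_zero_iff.1 ((π n).len [] (h _))⟩⟩

variable [∀ n, Inhabited (B n)] {c : ∀ n, Covering (S (n + 1)) (S n)} {K : ℕ → ℕ}

/-- The tree homomorphisms underlying a sequence of coverings. -/
abbrev homs (c : ∀ n, Covering (S (n + 1)) (S n)) (n : ℕ) : TreeHom (S (n + 1)) (S n) := (c n).π

theorem limTree_eq_of_proj_eq (hK : Monotone K) (hc : ∀ n, IsFixing (K n) (c n))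
    {x y : List (∀ n, B n)} (hx : x ∈ limTree (homs c)) (hy : y ∈ limTree (homs c)) {m : ℕ}
    (hm : x.length ≤ K m) (h : proj m x = proj m y) : x = y := by
  have hdown : ∀ n, proj (n + 1) x = proj (n + 1) y → proj n x = proj n y := fun n hn => by
    rw [← (hx n).2, hn, (hy n).2]
  refine proj_ext fun n => ?_
  rcases le_total n m with hnm | hnm
  · revert h
    clear hm
    induction m, hnm using Nat.le_induction with
    | base => exact _root_.id
    | succ m _ ih => exact fun h => ih (hdown m h)
  · induction n, hnm using Nat.le_induction with
    | base => exact h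
    | succ n hmn ih =>
      refine (hc n).injective (hx _).1 (hy _).1 ?_ ?_
      · rw [length_proj]; exact hm.trans (hK hmn)
      · exact (hx n).2.trans (ih.trans (hy n).2.symm)

theorem exists_family (m : ℕ) : ∀ {B : ℕ → Type u} {S : ∀ n, Set (List (B n))}
    [∀ n, Inhabited (B n)] {c : ∀ n, Covering (S (n + 1)) (S n)} {K : ℕ → ℕ} (_ : Monotone K)
    (_ : ∀ n, IsFixing (K n) (c n)) {x : List (B m)} (_ : x ∈ S m) (_ : x.length ≤ K m),
    ∃ y : ∀ n, List (B n), (∀ n, y n ∈ S n ∧ (c n).π.toFun (y (n + 1)) = y n) ∧ y m = x := by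
  induction m with
  | zero =>
    intro B S _ c K hK hc x hx hl
    have step : ∀ n (z : {z : List (B n) // z ∈ S n ∧ z.length = x.length}),
        ∃ z' : {z : List (B (n + 1)) // z ∈ S (n + 1) ∧ z.length = x.length},
          (c n).π.toFun z'.1 = z.1 := by
      rintro n ⟨z, hz, hzl⟩
      obtain ⟨z', hz', rfl⟩ := (hc n).surjective hz
        (by rw [hzl]; exact hl.trans (hK (Nat.zero_le n)))
      exact ⟨⟨z', hz', by rw [← hzl, (c n).π.len _ hz']⟩, rfl⟩
    choose f hf using step
    let y : ∀ n, {z : List (B n) // z ∈ S n ∧ z.length = x.length} :=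
      fun n => Nat.rec ⟨x, hx, rfl⟩ (fun n z => f n z) n
    exact ⟨fun n => (y n).1, fun n => ⟨(y n).2.1, hf n (y n)⟩, rfl⟩
  | succ m ih =>
    intro B S _ c K hK hc x hx hl
    obtain ⟨y, hy, rfl⟩ := ih (B := fun n => B (n + 1)) (S := fun n => S (n + 1))
      (c := fun n => c (n + 1)) (K := fun n => K (n + 1))
      (fun _ _ h => hK (Nat.succ_le_succ h)) (fun n => hc (n + 1)) hx hl
    refine ⟨fun n => Nat.casesOn n ((c 0).π.toFun (y 0)) y, fun n => ?_, rfl⟩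
    cases n with
    | zero => exact ⟨(c 0).π.mem _ (hy 0).1, rfl⟩
    | succ n => exact hy n

theorem exists_limTree_lift (hK : Monotone K) (hc : ∀ n, IsFixing (K n) (c n)) {m : ℕ}
    {x : List (B m)} (hx : x ∈ S m) (hl : x.length ≤ K m) :
    ∃ x' ∈ limTree (homs c), proj m x' = x := by
  obtain ⟨y, hy, rfl⟩ := exists_family m hK hc hx hl
  have hlen : ∀ n, (y n).length = (y 0).length := fun n => by
    induction n with
    | zero => rfl
    | succ n ih => rw [← ih, ← (hy n).2, (c n).π.len _ (hy _).1]
  obtain ⟨x', hx'⟩ := exists_proj_eq y hlen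
  exact ⟨x', fun n => by rw [hx', hx']; exact hy n, hx' m⟩

theorem isPruned_limTree (hK : Monotone K) (hc : ∀ n, IsFixing (K n) (c n)) (hKn : ∀ n, n ≤ K n)
    (hS : ∀ n, IsTree (S n)) (hp : ∀ n, IsPruned (S n)) : IsPruned (limTree (homs c)) := by
  intro x hx
  obtain ⟨b, hb⟩ := hp _ _ (hx (x.length + 1)).1
  obtain ⟨z, hz, hzb⟩ := exists_limTree_lift hK hc hb (by simpa using hKn (x.length + 1))
  have hzl : z.length = x.length + 1 := by simpa using congrArg List.length hzb
  have hz' : z.take x.length ∈ limTree (homs c) := isTree_limTree hS (List.take_prefix _ _) hz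
  have : x = z.take x.length := by
    refine limTree_eq_of_proj_eq hK hc hx hz' (m := x.length + 1)
      ((Nat.le_succ _).trans (hKn _)) ?_
    change _ = List.map _ _
    rw [List.map_take]
    change _ = (proj _ z).take _
    rw [hzb]
    simp
  obtain ⟨a, ha⟩ := exists_append_of_prefix (this ▸ List.take_prefix _ _ : x <+: z) hzl
  exact ⟨a, ha ▸ hz⟩

open Classical in
/-- The strategy on stage `m` induced by a strategy on the inverse limit; it is relevant only at
positions of length less than `K m`. -/
noncomputable def restrict (K : ℕ → ℕ) (hp : ∀ n, IsPruned (S n)) {i : ℕ}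
    (σ : Strategy (limTree (homs c)) i) (m : ℕ) : Strategy (S m) i :=
  Strategy.ofMoves (hp m) i fun x =>
    if h : x.length < K m ∧ ∃ x' ∈ limTree (homs c), proj m x' = x then
      σ.move h.2.choose m
    else default

theorem restrict_move (hK : Monotone K) (hc : ∀ n, IsFixing (K n) (c n))
    (hp : ∀ n, IsPruned (S n)) {i : ℕ} (σ : Strategy (limTree (homs c)) i) {m : ℕ}
    {x : List (∀ n, B n)} (hx : x ∈ limTree (homs c)) (hl : x.length < K m)
    (hi : x.length % 2 = i % 2) :
    (restrict K hp σ m).move (proj m x) = σ.move x m := by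
  have h : (proj m x).length < K m ∧ ∃ x' ∈ limTree (homs c), proj m x' = proj m x :=
    ⟨by simpa using hl, x, hx, rfl⟩
  have hxe : h.2.choose = x := (limTree_eq_of_proj_eq hK hc hx h.2.choose_spec.1 hl.le
    h.2.choose_spec.2.symm).symm
  rw [restrict, Strategy.ofMoves_move]
  · rw [dif_pos h, hxe]
  · rw [dif_pos h, hxe, ← proj_append]
    exact (σ.legal x hx hi m).1

theorem restrict_agree (hp : ∀ n, IsPruned (S n)) {i n : ℕ}
    {σ σ' : Strategy (limTree (homs c)) i}
    (h : ∀ x ∈ limTree (homs c), x.length ≤ n → σ.move x = σ'.move x) (m : ℕ) :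
    AgreeUpTo n (restrict K hp σ m) (restrict K hp σ' m) := fun x _ _ hxn => by
  refine Strategy.ofMoves_congr _ _ ?_
  split_ifs with hx
  · rw [h _ hx.2.choose_spec.1]
    rw [← length_proj m, hx.2.choose_spec.2]
    exact hxn
  · rfl

/-- The strategy on stage `m` obtained by transporting the induced strategy on stage `m + d`. -/
noncomputable def transport (K : ℕ → ℕ) (hp : ∀ n, IsPruned (S n)) {i : ℕ}
    (σ : Strategy (limTree (homs c)) i) : ℕ → ∀ m, Strategy (S m) i
  | 0, m => restrict K hp σ m
  | d + 1, m => (c m).strat (transport K hp σ d (m + 1))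

theorem transport_agree (hp : ∀ n, IsPruned (S n)) {i n : ℕ}
    {σ σ' : Strategy (limTree (homs c)) i}
    (h : ∀ x ∈ limTree (homs c), x.length ≤ n → σ.move x = σ'.move x) (d : ℕ) (m : ℕ) :
    AgreeUpTo n (transport K hp σ d m) (transport K hp σ' d m) := by
  induction d generalizing m with
  | zero => exact restrict_agree hp h m
  | succ d ih => exact (c m).strat_agree (ih (m + 1))

theorem transport_succ (hK : Monotone K) (hc : ∀ n, IsFixing (K n) (c n))
    (hp : ∀ n, IsPruned (S n)) {i n : ℕ} (σ : Strategy (limTree (homs c)) i) (d m : ℕ)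
    (hn : n < K (m + d)) :
    AgreeUpTo n (transport K hp σ (d + 1) m) (transport K hp σ d m) := by
  induction d generalizing m with
  | zero =>
    intro x hx hi hxn
    have hxK : x.length < K m := hxn.trans_lt hn
    obtain ⟨x', hx', rfl⟩ := exists_limTree_lift hK hc hx hxK.le
    rw [length_proj] at hi hxK
    change ((c m).strat (restrict K hp σ (m + 1))).move _ = (restrict K hp σ m).move _
    rw [restrict_move hK hc hp σ hx' hxK hi]
    have h1 := (hc m).strat_induced (restrict K hp σ (m + 1)) (hx' (m + 1)).1
      (by simpa using hxK) (by simpa using hi)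
    rw [restrict_move hK hc hp σ hx' (hxK.trans_le (hK (Nat.le_succ m))) hi, ← proj_append,
      (hx' m).2] at h1
    have h2 := (σ.legal x' hx' hi m).2
    rw [h1, proj_append] at h2
    simpa using h2
  | succ d ih => exact (c m).strat_agree (ih (m + 1) (by rwa [Nat.add_right_comm]))

theorem transport_le (hK : Monotone K) (hc : ∀ n, IsFixing (K n) (c n))
    (hp : ∀ n, IsPruned (S n)) {i n : ℕ} (σ : Strategy (limTree (homs c)) i) {d d' : ℕ} (m : ℕ)
    (hd : d ≤ d') (hn : n < K (m + d)) :
    AgreeUpTo n (transport K hp σ d' m) (transport K hp σ d m) := by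
  induction d', hd using Nat.le_induction with
  | base => exact fun _ _ _ _ => rfl
  | succ d' hdd ih =>
    intro x hx hi hxn
    rw [transport_succ hK hc hp σ d' m (hn.trans_le (hK (by omega))) x hx hi hxn,
      ih x hx hi hxn]

/-- The strategy on stage `m` obtained as the limit of the transported strategies. -/
noncomputable def limStrat (K : ℕ → ℕ) (hp : ∀ n, IsPruned (S n)) {i : ℕ}
    (σ : Strategy (limTree (homs c)) i) (m : ℕ) : Strategy (S m) i where
  move x := if x.length % 2 = i % 2 then (transport K hp σ (x.length + 1) m).move x else default
  legal x hx hi := by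
    rw [if_pos hi]
    exact (transport K hp σ (x.length + 1) m).legal x hx hi

theorem limStrat_move (hK : Monotone K) (hc : ∀ n, IsFixing (K n) (c n)) (hKn : ∀ n, n ≤ K n)
    (hp : ∀ n, IsPruned (S n)) {i : ℕ} (σ : Strategy (limTree (homs c)) i) {d m : ℕ}
    {x : List (B m)} (hx : x ∈ S m) (hi : x.length % 2 = i % 2) (hd : x.length < K (m + d)) :
    (limStrat K hp σ m).move x = (transport K hp σ d m).move x := by
  have hd' : x.length < K (m + (x.length + 1)) := by
    have := hKn (m + (x.length + 1))
    omega
  change (if _ then _ else _) = _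
  rw [if_pos hi]
  rcases le_total d (x.length + 1) with h | h
  · exact transport_le hK hc hp σ m h hd x hx hi le_rfl
  · exact (transport_le hK hc hp σ m h hd' x hx hi le_rfl).symm

theorem limStrat_eq_strat (hK : Monotone K) (hc : ∀ n, IsFixing (K n) (c n))
    (hKn : ∀ n, n ≤ K n) (hp : ∀ n, IsPruned (S n)) {i : ℕ}
    (σ : Strategy (limTree (homs c)) i) (m n : ℕ) :
    AgreeUpTo n (limStrat K hp σ m) ((c m).strat (limStrat K hp σ (m + 1))) := by
  intro x hx hi hxn
  have hd : x.length < K (m + (x.length + 1)) := by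
    have := hKn (m + (x.length + 1))
    omega
  have hd' : ∀ l ≤ x.length, l < K (m + 1 + x.length) := fun l hl => by
    have := hKn (m + 1 + x.length)
    omega
  rw [limStrat_move hK hc hKn hp σ hx hi hd]
  refine (c m).strat_agree (n := x.length) ?_ x hx hi le_rfl
  intro y hy hyi hyn
  exact (limStrat_move hK hc hKn hp σ hy hyi (hd' _ hyn)).symm

theorem limStrat_lift (hK : Monotone K) (hc : ∀ n, IsFixing (K n) (c n))
    (hKn : ∀ n, n ≤ K n) (hp : ∀ n, IsPruned (S n)) {i : ℕ}
    (σ : Strategy (limTree (homs c)) i) {a : ℕ → B 0} (ha : a ∈ plays (limStrat K hp σ 0)) :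
    ∃ a' ∈ plays σ, bodyMap (limHom (homs c) 0).toFun a' = a := by
  have step : ∀ m (b : {b : ℕ → B m // b ∈ plays (limStrat K hp σ m)}),
      ∃ b' : {b : ℕ → B (m + 1) // b ∈ plays (limStrat K hp σ (m + 1))},
        bodyMap (c m).π.toFun b'.1 = b.1 := by
    rintro m ⟨b, hb⟩
    have hb' : b ∈ plays ((c m).strat (limStrat K hp σ (m + 1))) :=
      ⟨hb.1, fun n hn => by
        rw [Strategy.eq_of_plays hb hn]
        exact limStrat_eq_strat hK hc hKn hp σ m n _ (pre_mem hb.1 n) (by simpa using hn)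
          (by simp)⟩
    obtain ⟨b', h1, h2⟩ := (c m).strat_lift _ hb'
    exact ⟨⟨b', h1⟩, h2⟩
  choose f hf using step
  let b : ∀ n, {b : ℕ → B n // b ∈ plays (limStrat K hp σ n)} :=
    fun n => Nat.rec ⟨a, ha⟩ (fun n z => f n z) n
  have hb : ∀ n, bodyMap (c n).π.toFun (b (n + 1)).1 = (b n).1 := fun n => hf n (b n)
  let a' : ℕ → ∀ n, B n := fun j n => (b n).1 j
  have hproj : ∀ n l, proj n (pre a' l) = pre (b n).1 l := fun n l => proj_pre a' n l
  have hbody : a' ∈ body (limTree (homs c)) := fun l n => by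
    change proj n (pre a' l) ∈ _ ∧ _ = proj n (pre a' l)
    change _ ∧ (c n).π.toFun (proj (n + 1) (pre a' l)) = _
    rw [hproj, hproj, (c n).π.toFun_pre (b _).2.1, hb]
    exact ⟨pre_mem (b n).2.1 l, rfl⟩
  refine ⟨a', ⟨hbody, fun l hl => ?_⟩, (limHom (homs c) 0).bodyMap_eq hbody fun l => hproj 0 l⟩
  have hli : (pre a' l).length % 2 = i % 2 := by simpa using hl
  have hleg := σ.legal _ (pre_mem hbody l) hli
  have hnext : pre a' (l + 1) = pre a' l ++ [σ.move (pre a' l)] := by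
    refine limTree_eq_of_proj_eq hK hc (pre_mem hbody _) hleg (m := l + 1)
      (by simpa using hKn (l + 1)) ?_
    have hbl := Strategy.eq_of_plays (b (l + 1)).2 hl
    have hlK : l < K (l + 1 + 0) := hKn (l + 1)
    rw [proj_append, hproj, pre_succ, hbl,
      limStrat_move hK hc hKn hp σ (d := 0) (pre_mem (b _).2.1 l) (by simpa using hl)
        (by simpa using hlK), ← hproj (l + 1) l, transport,
      restrict_move hK hc hp σ (pre_mem hbody l) (by simpa using hlK) hli]
  rw [pre_succ] at hnext
  have := (List.append_inj' hnext rfl).2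
  exact (List.cons.inj this).1

/-- The covering of the initial stage by the inverse limit. -/
noncomputable def limCovering (hK : Monotone K) (hc : ∀ n, IsFixing (K n) (c n))
    (hKn : ∀ n, n ≤ K n) (hp : ∀ n, IsPruned (S n)) :
    Covering (limTree (homs c)) (S 0) where
  π := limHom (homs c) 0
  φ _ σ := limStrat K hp σ 0
  agree i n σ σ' h x hx hxn := by
    change (if _ then _ else _) = (if _ then _ else _)
    split_ifs with hi
    · exact transport_agree hp h _ 0 x hx hi hxn
    · rfl
  lift _ σ _ ha := limStrat_lift hK hc hKn hp σ ha

theorem isFixing_limCovering (hK : Monotone K) (hc : ∀ n, IsFixing (K n) (c n))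
    (hKn : ∀ n, n ≤ K n) (hp : ∀ n, IsPruned (S n)) :
    IsFixing (K 0) (limCovering hK hc hKn hp) :=
  isFixing_of_bijOn (fun _ hx _ hy hl h => limTree_eq_of_proj_eq hK hc hx hy hl h)
    (fun _ hy hl => exists_limTree_lift hK hc hy hl)
    (fun i σ x hx hl hi => by
      change proj 0 (x ++ _) = proj 0 x ++ [(limStrat K hp σ 0).move (proj 0 x)]
      rw [limStrat_move hK hc hKn hp σ (d := 0) (hx 0).1 (by simpa using hi) (by simpa using hl),
        transport, restrict_move hK hc hp σ hx hl hi, proj_append])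

end Limit

section OpenGames

variable {A : Type u}

/-- The set `K` of positions witnesses that the player moving at positions of parity `j` can force
the play, starting at `x` and moving in `E`, to reach `O`. -/
structure Attack (j : ℕ) (E O : Set (List A)) (x : List A) (K : Set (List A)) : Prop where
  mem : x ∈ K
  sub : ∀ y ∈ K, x <+: y ∧ y ∈ E
  own : ∀ y ∈ K, y ∉ O → y.length % 2 = j → ∃ a, y ++ [a] ∈ K
  opp : ∀ y ∈ K, y ∉ O → y.length % 2 ≠ j → ∀ a, y ++ [a] ∈ E → y ++ [a] ∈ K
  hit : ∀ a : ℕ → A, (∀ n, x.length ≤ n → pre a n ∈ K) → ∃ n, x.length ≤ n ∧ pre a n ∈ O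

/-- The positions from which the player moving at positions of parity `j` can force reaching `O`
inside `E`. -/
def Wins (j : ℕ) (E O : Set (List A)) : Set (List A) := {x | ∃ K, Attack j E O x K}

variable {j : ℕ} {E O : Set (List A)}

theorem mem_wins_of_mem {x : List A} (hE : x ∈ E) (hO : x ∈ O) : x ∈ Wins j E O := by
  refine ⟨{x}, rfl, ?_, ?_, ?_, fun a ha => ⟨_, le_rfl, ?_⟩⟩
  · rintro y rfl
    exact ⟨List.prefix_rfl, hE⟩
  · rintro y rfl h
    exact absurd hO h
  · rintro y rfl h
    exact absurd hO h
  · rwa [show pre a x.length = x from ha _ le_rfl]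

theorem mem_wins_of_append {x : List A} (hx : x ∈ E) (M : Set A)
    (hM : ∀ a ∈ M, x ++ [a] ∈ Wins j E O) (hown : x.length % 2 = j → M.Nonempty)
    (hopp : x.length % 2 ≠ j → ∀ a, x ++ [a] ∈ E → a ∈ M) : x ∈ Wins j E O := by
  by_cases hxO : x ∈ O
  · exact mem_wins_of_mem hx hxO
  choose! K hK using hM
  refine ⟨{y | y = x ∨ ∃ a ∈ M, y ∈ K a}, Or.inl rfl, ?_, ?_, ?_, ?_⟩
  · rintro y (rfl | ⟨a, ha, hy⟩)
    · exact ⟨List.prefix_rfl, hx⟩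
    · exact ⟨(List.prefix_append _ _).trans ((hK a ha).sub y hy).1, ((hK a ha).sub y hy).2⟩
  · rintro y (rfl | ⟨a, ha, hy⟩) hyO hyj
    · obtain ⟨a, ha⟩ := hown hyj
      exact ⟨a, Or.inr ⟨a, ha, (hK a ha).mem⟩⟩
    · obtain ⟨b, hb⟩ := (hK a ha).own y hy hyO hyj
      exact ⟨b, Or.inr ⟨a, ha, hb⟩⟩
  · rintro y (rfl | ⟨a, ha, hy⟩) hyO hyj b hb
    · have hbM := hopp hyj b hb
      exact Or.inr ⟨b, hbM, (hK b hbM).mem⟩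
    · exact Or.inr ⟨a, ha, (hK a ha).opp y hy hyO hyj b hb⟩
  · intro a ha
    have key : ∀ n, x.length + 1 ≤ n → ∃ b ∈ M, pre a n ∈ K b := fun n hn =>
      (ha n (by omega)).resolve_left fun h => by
        have := congrArg List.length h
        simp at this
        omega
    obtain ⟨b, hb, hbK⟩ := key _ le_rfl
    have hpre : pre a (x.length + 1) = x ++ [b] :=
      (eq_of_prefix_of_prefix ((hK b hb).sub _ hbK).1 List.prefix_rfl (by simp)).symm
    obtain ⟨n, hn, hnO⟩ := (hK b hb).hit a fun n hn => by
      rw [List.length_append, List.length_singleton] at hn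
      obtain ⟨b', hb', hbK'⟩ := key n hn
      have h1 := eq_of_prefix_of_prefix ((hK b' hb').sub _ hbK').1 (pre_prefix_pre a hn) (by simp)
      rw [hpre] at h1
      have h2 : b' = b := by simpa using h1
      exact h2 ▸ hbK'
    exact ⟨n, (by simp at hn; omega), hnO⟩

/-- A quasistrategy for the player moving at positions of parity different from `j`, starting at
`q` and with moves in `E`. -/
structure Quasi (j : ℕ) (E : Set (List A)) (q : List A) (R : Set (List A)) : Prop where
  mem : q ∈ R
  sub : ∀ x ∈ R, q <+: x ∧ x ∈ E
  opp : ∀ x ∈ R, x.length % 2 = j → ∀ a, x ++ [a] ∈ E → x ++ [a] ∈ R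
  own : ∀ x ∈ R, x.length % 2 ≠ j → ∃ a, x ++ [a] ∈ R
  closed : ∀ x ∈ R, ∀ y, q <+: y → y <+: x → y ∈ R

/-- The positions reachable from `q` without entering `Wins j E O`. -/
def Safe (j : ℕ) (E O : Set (List A)) (q : List A) : Set (List A) :=
  {x | q <+: x ∧ ∀ y, q <+: y → y <+: x → y ∈ E ∧ y ∉ Wins j E O}

theorem safe_append {q x : List A} {a : A} (hx : x ∈ Safe j E O q) (hE : x ++ [a] ∈ E)
    (hW : x ++ [a] ∉ Wins j E O) : x ++ [a] ∈ Safe j E O q := by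
  refine ⟨hx.1.trans (List.prefix_append _ _), fun y hqy hy => ?_⟩
  rcases List.prefix_concat_iff.1 hy with rfl | h
  · exact ⟨hE, hW⟩
  · exact hx.2 y hqy h

theorem notMem_of_mem_safe {q x : List A} (hx : x ∈ Safe j E O q) : x ∉ O := fun h =>
  (hx.2 x hx.1 List.prefix_rfl).2 (mem_wins_of_mem (hx.2 x hx.1 List.prefix_rfl).1 h)

theorem quasi_safe {q : List A} (hE : q ∈ E) (hW : q ∉ Wins j E O) :
    Quasi j E q (Safe j E O q) where
  mem := ⟨List.prefix_rfl, fun y h1 h2 => by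
    rw [eq_of_prefix_of_prefix h2 List.prefix_rfl (h2.length_le.antisymm h1.length_le)]
    exact ⟨hE, hW⟩⟩
  sub x hx := ⟨hx.1, (hx.2 x hx.1 List.prefix_rfl).1⟩
  opp x hx hj a ha := by
    obtain ⟨h1, h2⟩ := hx.2 x hx.1 List.prefix_rfl
    refine safe_append hx ha fun hw => h2 ?_
    exact mem_wins_of_append h1 {a} (by rintro _ rfl; exact hw) (fun _ => ⟨a, rfl⟩)
      fun h => absurd hj h
  own x hx hj := by
    obtain ⟨h1, h2⟩ := hx.2 x hx.1 List.prefix_rfl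
    by_contra! hcon
    refine h2 (mem_wins_of_append h1 {a | x ++ [a] ∈ E} (fun a ha => ?_)
      (fun h => absurd h hj) fun _ a ha => ha)
    by_contra hw
    exact hcon a (safe_append hx ha hw)
  closed x hx y hqy hyx := ⟨hqy, fun z hz hzy => hx.2 z hz (hzy.trans hyx)⟩

theorem quasi_self {T : Set (List A)} (hT : IsTree T) (hp : IsPruned T) {q : List A} (hq : q ∈ T) :
    Quasi j T q {x ∈ T | q <+: x} where
  mem := ⟨hq, List.prefix_rfl⟩
  sub _ hx := ⟨hx.2, hx.1⟩
  opp _ hx _ _ ha := ⟨ha, hx.2.trans (List.prefix_append _ _)⟩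
  own x hx _ := by
    obtain ⟨a, ha⟩ := hp x hx.1
    exact ⟨a, ha, hx.2.trans (List.prefix_append _ _)⟩
  closed _ hx _ h1 h2 := ⟨hT h2 hx.1, h1⟩

/-- `x` has length at least `b` and lies in `W`, and `b` and `W` admit no shorter prefix of `x`
with these properties. -/
def FirstIn (b : ℕ) (W : Set (List A)) (x : List A) : Prop :=
  b ≤ x.length ∧ x ∈ W ∧ ∀ y, y <+: x → b ≤ y.length → y ∈ W → y = x

theorem exists_firstIn {b : ℕ} {W : Set (List A)} {x : List A} (hb : b ≤ x.length) (hx : x ∈ W) :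
    ∃ y, y <+: x ∧ FirstIn b W y := by
  classical
  have hex : ∃ n, ∃ y, y <+: x ∧ b ≤ y.length ∧ y ∈ W ∧ y.length = n :=
    ⟨_, x, List.prefix_rfl, hb, hx, rfl⟩
  obtain ⟨y, hyx, hyb, hyW, hyl⟩ := Nat.find_spec hex
  refine ⟨y, hyx, hyb, hyW, fun z hzy hzb hzW => ?_⟩
  refine eq_of_prefix_of_prefix hzy List.prefix_rfl (hzy.length_le.antisymm ?_)
  rw [hyl]
  exact Nat.find_min' hex ⟨z, hzy.trans hyx, hzb, hzW, rfl⟩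

theorem FirstIn.eq {b : ℕ} {W : Set (List A)} {x y z : List A} (hx : FirstIn b W x)
    (hy : FirstIn b W y) (hxz : x <+: z) (hyz : y <+: z) : x = y := by
  rcases List.prefix_or_prefix_of_prefix hxz hyz with h | h
  · exact hy.2.2 x h hx.1 hx.2.1
  · exact (hx.2.2 y h hy.1 hy.2.1).symm

/-- A witness for a position in `Wins j E O`. -/
noncomputable def attackSet (j : ℕ) (E O : Set (List A)) (x : List A) : Set (List A) :=
  Classical.epsilon (Attack j E O x)

theorem attack_attackSet {x : List A} (hx : x ∈ Wins j E O) :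
    Attack j E O x (attackSet j E O x) := Classical.epsilon_spec hx

/-- The move of a player who attacks `O` as soon as the play has entered `Wins j E O`. -/
noncomputable def attackMove [Inhabited A] (j : ℕ) (E O : Set (List A)) (b : ℕ) (p : List A) : A :=
  Classical.epsilon fun a =>
    ∃ y, y <+: p ∧ FirstIn b (Wins j E O) y ∧ p ++ [a] ∈ attackSet j E O y

theorem exists_pre_mem_of_attack [Inhabited A] {b : ℕ} {a : ℕ → A}
    (hopp : ∀ n, b ≤ n → n % 2 ≠ j → pre a n ∈ E → pre a (n + 1) ∈ E)
    (hown : ∀ n, b ≤ n → n % 2 = j → (∀ m, b ≤ m → m ≤ n → pre a m ∉ O) →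
      (∃ m, b ≤ m ∧ m ≤ n ∧ pre a m ∈ Wins j E O) →
      pre a n ++ [attackMove j E O b (pre a n)] ∈ E → a n = attackMove j E O b (pre a n))
    (hW : ∃ n, b ≤ n ∧ pre a n ∈ Wins j E O) : ∃ n, b ≤ n ∧ pre a n ∈ O := by
  by_contra! hcon
  obtain ⟨n₀, hn₀, hw⟩ := hW
  obtain ⟨y, hy, hyf⟩ := exists_firstIn (by simpa using hn₀) hw
  obtain ⟨m, rfl⟩ : ∃ m, y = pre a m := ⟨_, eq_pre_of_prefix hy⟩
  have hbm : b ≤ m := by simpa using hyf.1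
  have hK := attack_attackSet hyf.2.1
  have hin : ∀ n, m ≤ n → pre a n ∈ attackSet j E O (pre a m) := by
    intro n hn
    induction n, hn using Nat.le_induction with
    | base => exact hK.mem
    | succ n hmn ih =>
      have hnO := hcon n (hbm.trans hmn)
      by_cases hj : n % 2 = j
      · have hex : ∃ c, ∃ y, y <+: pre a n ∧ FirstIn b (Wins j E O) y ∧
            pre a n ++ [c] ∈ attackSet j E O y := by
          obtain ⟨c, hc⟩ := hK.own _ ih hnO (by simpa using hj)
          exact ⟨c, _, pre_prefix_pre a hmn, hyf, hc⟩
        obtain ⟨y, hyp, hyf', hmem⟩ := Classical.epsilon_spec hex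
        rw [hyf'.eq hyf hyp (pre_prefix_pre a hmn)] at hmem
        rw [pre_succ, hown n (hbm.trans hmn) hj (fun l hl _ => hcon l hl)
          ⟨m, hbm, hmn, hyf.2.1⟩ (hK.sub _ hmem).2]
        exact hmem
      · rw [pre_succ]
        refine hK.opp _ ih hnO (by simpa using hj) _ ?_
        rw [← pre_succ]
        exact hopp n (hbm.trans hmn) hj (hK.sub _ ih).2
  obtain ⟨n, hn, hnO⟩ := hK.hit a (by simpa using hin)
  exact hcon n (hbm.trans (by simpa using hn)) hnO

end OpenGames

section Unravel

variable {A : Type u}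

/-- The label of the move at position `n`: the moves `k` and `k + 1` carry the sets `Q` and `R`. -/
def lab (k n : ℕ) (Q R : Set (List A)) : Set (List A) :=
  if n = k then Q else if n = k + 1 then R else ∅

theorem lab_self (k : ℕ) (Q R : Set (List A)) : lab k k Q R = Q := if_pos rfl

theorem lab_succ (k : ℕ) (Q R : Set (List A)) : lab k (k + 1) Q R = R := by simp [lab]

theorem lab_of_ne {k n : ℕ} {Q R : Set (List A)} (h : n ≠ k) (h' : n ≠ k + 1) :
    lab k n Q R = ∅ := by simp [lab, h, h']

/-- The position `p` with labels attached to its moves. -/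
def annotate (k : ℕ) (p : List A) (Q R : Set (List A)) : List (A × Set (List A)) :=
  p.mapIdx fun n a => (a, lab k n Q R)

variable {k : ℕ}

@[simp] theorem length_annotate (p : List A) (Q R : Set (List A)) :
    (annotate k p Q R).length = p.length := by simp [annotate]

@[simp] theorem map_fst_annotate (p : List A) (Q R : Set (List A)) :
    (annotate k p Q R).map Prod.fst = p := by
  refine List.ext_getElem (by simp) fun n h h' => ?_
  simp [annotate]

theorem annotate_append (p : List A) (a : A) (Q R : Set (List A)) :
    annotate k (p ++ [a]) Q R = annotate k p Q R ++ [(a, lab k p.length Q R)] := by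
  simp [annotate]

theorem annotate_congr {p : List A} {Q Q' R R' : Set (List A)}
    (hQ : k < p.length → Q = Q') (hR : k + 1 < p.length → R = R') :
    annotate k p Q R = annotate k p Q' R' := by
  refine List.ext_getElem (by simp) fun n h h' => ?_
  have hn : n < p.length := by simpa using h
  simp only [annotate, List.getElem_mapIdx, lab]
  split_ifs with h1 h2
  · exact congrArg _ (hQ (h1 ▸ hn))
  · exact congrArg _ (hR (h2 ▸ hn))
  · rfl

theorem annotate_inj {p p' : List A} {Q Q' R R' : Set (List A)}
    (h : annotate k p Q R = annotate k p' Q' R') :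
    p = p' ∧ (k < p.length → Q = Q') ∧ (k + 1 < p.length → R = R') := by
  have hp : p = p' := by
    rw [← map_fst_annotate (k := k) p Q R, h, map_fst_annotate]
  subst hp
  have key : ∀ n, n < p.length → lab k n Q R = lab k n Q' R' := fun n hn => by
    have h1 : (annotate k p Q R)[n]'(by simpa using hn) =
      (annotate k p Q' R')[n]'(by simpa using hn) := by simp only [h]
    simpa [annotate] using h1
  refine ⟨rfl, fun hk => ?_, fun hk => ?_⟩
  · simpa [lab_self] using key k hk
  · simpa [lab_succ] using key (k + 1) hk

theorem pre_annotate (a : ℕ → A) (Q R : Set (List A)) (n : ℕ) :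
    pre (fun j => (a j, lab k j Q R)) n = annotate k (pre a n) Q R := by
  induction n with
  | zero => simp [annotate]
  | succ n ih => rw [pre_succ, pre_succ, annotate_append, ih, length_pre]

/-- The positions of `T` compatible with `u`. -/
def cone (T : Set (List A)) (u : List A) : Set (List A) := {y ∈ T | y <+: u ∨ u <+: y}

/-- The options of the second player after the quasistrategy `Q` has been proposed: either point
at a position of `O` reachable in `Q`, or propose a quasistrategy inside `Q` avoiding `O`. -/
def Option₂ (T O Q R : Set (List A)) (q : List A) : Prop :=
  (∃ u ∈ Q, u ∈ O ∧ q <+: u ∧ R = cone T u) ∨ (Quasi 0 Q q R ∧ ∀ x ∈ R, x ∉ O)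

/-- The legal annotated positions of the unraveled game. -/
structure Legal (T O : Set (List A)) (k : ℕ) (p : List A) (Q R : Set (List A)) : Prop where
  mem : p ∈ T
  left : k < p.length → Quasi 1 T (p.take (k + 1)) Q
  right : k + 1 < p.length → Option₂ T O Q R (p.take (k + 2))
  memR : k + 1 < p.length → p ∈ R

/-- The tree of the unraveled game. -/
def unravelTree (T O : Set (List A)) (k : ℕ) : Set (List (A × Set (List A))) :=
  {x | ∃ p Q R, x = annotate k p Q R ∧ Legal T O k p Q R}

variable {T O : Set (List A)}

theorem Legal.congr {p : List A} {Q Q' R R' : Set (List A)} (h : Legal T O k p Q R)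
    (hQ : k < p.length → Q = Q') (hR : k + 1 < p.length → R = R') : Legal T O k p Q' R' where
  mem := h.mem
  left hk := hQ hk ▸ h.left hk
  right hk := hQ (by omega) ▸ hR hk ▸ h.right hk
  memR hk := hR hk ▸ h.memR hk

theorem annotate_mem_iff {p : List A} {Q R : Set (List A)} :
    annotate k p Q R ∈ unravelTree T O k ↔ Legal T O k p Q R := by
  refine ⟨?_, fun h => ⟨p, Q, R, rfl, h⟩⟩
  rintro ⟨p', Q', R', h, hL⟩
  obtain ⟨rfl, hQ, hR⟩ := annotate_inj h
  exact hL.congr (fun h => (hQ h).symm) fun h => (hR h).symm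

theorem legal_of_append {p : List A} {Q R : Set (List A)} {b : A × Set (List A)}
    (h : annotate k p Q R ++ [b] ∈ unravelTree T O k) :
    b.2 = lab k p.length b.2 b.2 ∧
      Legal T O k (p ++ [b.1]) (if p.length = k then b.2 else Q)
        (if p.length = k + 1 then b.2 else R) := by
  obtain ⟨p', Q', R', he, hL⟩ := h
  have hp : p' = p ++ [b.1] := by
    simpa using (congrArg (List.map Prod.fst) he).symm
  subst hp
  rw [annotate_append] at he
  obtain ⟨h1, h2⟩ := List.append_inj' he rfl
  have hb : b.2 = lab k p.length Q' R' := congrArg Prod.snd (List.cons.inj h2).1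
  obtain ⟨-, hQ, hR⟩ := annotate_inj h1
  have hlen : (p ++ [b.1]).length = p.length + 1 := by simp
  refine ⟨?_, hL.congr (fun hk => ?_) fun hk => ?_⟩
  · rw [hb]
    simp only [lab]
    split_ifs <;> rfl
  · split_ifs with hpk
    · rw [hb, hpk, lab_self]
    · exact (hQ (by omega)).symm
  · split_ifs with hpk
    · rw [hb, hpk, lab_succ]
    · exact (hR (by omega)).symm

theorem Legal.of_prefix (hT : IsTree T) {p p' : List A} {Q R : Set (List A)}
    (h : Legal T O k p Q R) (hp : p' <+: p) : Legal T O k p' Q R := by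
  have hl := hp.length_le
  have htake : ∀ n, n ≤ p'.length → p'.take n = p.take n := fun n hn =>
    eq_of_prefix_of_prefix ((List.take_prefix _ _).trans hp) (List.take_prefix _ _)
      (by simp; omega)
  refine ⟨hT hp h.mem, fun hk => ?_, fun hk => ?_, fun hk => ?_⟩
  · rw [htake _ hk]
    exact h.left (by omega)
  · rw [htake _ hk]
    exact h.right (by omega)
  · have hmem := h.memR (by omega)
    rcases h.right (by omega) with ⟨u, -, -, -, rfl⟩ | ⟨hq, -⟩
    · refine ⟨hT hp h.mem, ?_⟩
      rcases hmem.2 with hu | hu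
      · exact Or.inl (hp.trans hu)
      · exact List.prefix_or_prefix_of_prefix hp hu
    · refine hq.closed _ hmem _ ?_ hp
      rw [← htake _ hk]
      exact List.take_prefix _ _

theorem isTree_unravelTree (hT : IsTree T) : IsTree (unravelTree T O k) := by
  rintro x _ hx ⟨p, Q, R, rfl, hL⟩
  have hp : x.map Prod.fst <+: p := by
    simpa using hx.map Prod.fst
  refine ⟨_, Q, R, ?_, hL.of_prefix hT hp⟩
  refine eq_of_prefix_of_prefix hx ?_ (by simp)
  obtain ⟨t, ht⟩ := hp
  rw [← ht]
  clear hx hL ht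
  induction t using List.reverseRecOn with
  | nil => simp
  | append_singleton t a ih =>
    rw [← List.append_assoc, annotate_append]
    exact ih.trans (List.prefix_append _ _)

theorem nonempty_unravelTree (hT : IsTree T) (hne : T.Nonempty) :
    (unravelTree T O k).Nonempty :=
  ⟨[], [], ∅, ∅, by simp [annotate], hT List.nil_prefix hne.choose_spec,
    by simp, by simp, by simp⟩

theorem exists_cone_append (hT : IsTree T) (hp : IsPruned T) {u p : List A} (hu : u ∈ T)
    (h : p ∈ cone T u) : ∃ a, p ++ [a] ∈ cone T u := by
  by_cases hup : u <+: p
  · obtain ⟨a, ha⟩ := hp p h.1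
    exact ⟨a, ha, Or.inr (hup.trans (List.prefix_append _ _))⟩
  · have hpu := h.2.resolve_right hup
    obtain ⟨a, ha⟩ := append_singleton_prefix hpu
      (lt_of_not_ge fun hle => hup (by
        rw [eq_of_prefix_of_prefix hpu List.prefix_rfl (hpu.length_le.antisymm hle)]))
    exact ⟨a, hT ha hu, Or.inl ha⟩

theorem isPruned_unravelTree (hT : IsTree T) (hp : IsPruned T) (hk : k % 2 = 0) :
    IsPruned (unravelTree T O k) := by
  rintro _ ⟨p, Q, R, rfl, hL⟩
  suffices h : ∃ a Q' R', (k < p.length → Q = Q') ∧ (k + 1 < p.length → R = R') ∧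
      Legal T O k (p ++ [a]) Q' R' by
    obtain ⟨a, Q', R', hQ, hR, hL'⟩ := h
    refine ⟨(a, lab k p.length Q' R'), p ++ [a], Q', R', ?_, hL'⟩
    rw [annotate_append, annotate_congr hQ hR]
  have hlen : ∀ a : A, (p ++ [a]).length = p.length + 1 := by simp
  have htake : ∀ (a : A) n, n ≤ p.length → (p ++ [a]).take n = p.take n := fun a n hn => by
    rw [List.take_append_of_le_length hn]
  have htake' : ∀ (a : A), (p ++ [a]).take (p.length + 1) = p ++ [a] := fun a =>
    List.take_of_length_le (by simp)
  rcases lt_trichotomy p.length k with h | h | h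
  · obtain ⟨a, ha⟩ := hp p hL.mem
    refine ⟨a, Q, R, fun _ => rfl, fun _ => rfl, ha, ?_, ?_, ?_⟩ <;> intro hk' <;>
      rw [hlen] at hk' <;> omega
  · obtain ⟨a, ha⟩ := hp p hL.mem
    refine ⟨a, {x ∈ T | p ++ [a] <+: x}, R, fun _ => by omega, fun _ => rfl, ha, ?_, ?_, ?_⟩ <;>
      intro hk'
    · rw [← h, htake']
      exact quasi_self hT hp ha
    · rw [hlen] at hk'
      omega
    · rw [hlen] at hk'
      omega
  · have hQ := hL.left h
    rcases (Nat.succ_le_of_lt h).eq_or_lt with h' | h'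
    · have hpQ : p ∈ Q := by
        have := hQ.mem
        rwa [List.take_of_length_le h'.ge] at this
      obtain ⟨a, ha⟩ := hp p hL.mem
      have haQ := hQ.opp p hpQ (by omega) a ha
      suffices hR : ∃ R', Option₂ T O Q R' (p ++ [a]) ∧ p ++ [a] ∈ R' by
        obtain ⟨R', h1, h2⟩ := hR
        refine ⟨a, Q, R', fun _ => rfl, fun _ => by omega, ha, fun _ => ?_, fun _ => ?_,
          fun _ => h2⟩
        · rwa [htake _ _ h]
        · rwa [show k + 2 = p.length + 1 by omega, htake']
      by_cases hu : ∃ u ∈ Q, u ∈ O ∧ p ++ [a] <+: u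
      · obtain ⟨u, huQ, huO, hpu⟩ := hu
        exact ⟨cone T u, Or.inl ⟨u, huQ, huO, hpu, rfl⟩, ha, Or.inl hpu⟩
      · push Not at hu
        refine ⟨{x ∈ Q | p ++ [a] <+: x}, Or.inr ⟨⟨⟨haQ, List.prefix_rfl⟩, ?_, ?_, ?_, ?_⟩, ?_⟩,
          haQ, List.prefix_rfl⟩
        · exact fun x hx => ⟨hx.2, hx.1⟩
        · exact fun x hx _ b hb => ⟨hb, hx.2.trans (List.prefix_append _ _)⟩
        · intro x hx hx2
          obtain ⟨b, hb⟩ := hp x (hQ.sub x hx.1).2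
          exact ⟨b, hQ.opp x hx.1 (by omega) b hb, hx.2.trans (List.prefix_append _ _)⟩
        · refine fun x hx y h1 h2 => ⟨hQ.closed x hx.1 y ?_ h2, h1⟩
          rw [List.take_of_length_le h'.ge]
          exact (List.prefix_append _ _).trans h1
        · exact fun x hx hxO => hu x hx.1 hxO hx.2
    · have hR := hL.right h'
      have hpR := hL.memR h'
      suffices ha : ∃ a, p ++ [a] ∈ T ∧ p ++ [a] ∈ R by
        obtain ⟨a, ha, haR⟩ := ha
        refine ⟨a, Q, R, fun _ => rfl, fun _ => rfl, ha, fun _ => ?_, fun _ => ?_, fun _ => haR⟩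
        · rwa [htake _ _ h]
        · rwa [htake _ _ h']
      rcases hR with ⟨u, huQ, -, -, rfl⟩ | ⟨hqR, -⟩
      · obtain ⟨a, ha⟩ := exists_cone_append hT hp (hQ.sub u huQ).2 hpR
        exact ⟨a, ha.1, ha⟩
      · have hsub : ∀ a, p ++ [a] ∈ R → p ++ [a] ∈ T := fun a ha =>
          (hQ.sub _ (hqR.sub _ ha).2).2
        by_cases hpar : p.length % 2 = 0
        · obtain ⟨a, ha⟩ := hQ.own p (hqR.sub p hpR).2 (by omega)
          have haR := hqR.opp p hpR hpar a ha
          exact ⟨a, hsub a haR, haR⟩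
        · obtain ⟨a, ha⟩ := hqR.own p hpR hpar
          exact ⟨a, hsub a ha, ha⟩

/-- The projection from the unraveled game. -/
def unravelHom (T O : Set (List A)) (k : ℕ) : TreeHom (unravelTree T O k) T where
  toFun x := x.map Prod.fst
  mem := by
    rintro _ ⟨p, Q, R, rfl, hL⟩
    rw [map_fst_annotate]
    exact hL.mem
  len _ _ := by simp
  mono _ _ _ _ h := h.map _

end Unravel

section UnravelStrategies

variable {A : Type u} {k : ℕ} {T O : Set (List A)}

theorem legal_of_length_le {p : List A} (hp : p ∈ T) (hl : p.length ≤ k) (Q R : Set (List A)) :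
    Legal T O k p Q R :=
  ⟨hp, fun h => by omega, fun h => by omega, fun h => by omega⟩

theorem legal_pre {a : ℕ → A} (ha : a ∈ body T) {Q R : Set (List A)}
    (hQ : Quasi 1 T (pre a (k + 1)) Q) (hO : Option₂ T O Q R (pre a (k + 2))) {n : ℕ}
    (hR : k + 2 ≤ n → pre a n ∈ R) : Legal T O k (pre a n) Q R where
  mem := pre_mem ha n
  left h := by
    rw [length_pre] at h
    rwa [take_pre a h]
  right h := by
    rw [length_pre] at h
    rwa [take_pre a h]
  memR h := hR (by rwa [length_pre] at h)

theorem pre_mem_cone {a : ℕ → A} (ha : a ∈ body T) (m n : ℕ) : pre a n ∈ cone T (pre a m) :=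
  ⟨pre_mem ha n, (le_total n m).imp (pre_prefix_pre a) (pre_prefix_pre a)⟩

theorem lift_of_legal [Inhabited A] {i : ℕ} (σ : Strategy (unravelTree T O k) i) {a : ℕ → A}
    {Q R : Set (List A)} (hleg : ∀ n, Legal T O k (pre a n) Q R)
    (hQ : k % 2 = i % 2 → (σ.move (annotate k (pre a k) Q R)).2 = Q)
    (hR : (k + 1) % 2 = i % 2 → (σ.move (annotate k (pre a (k + 1)) Q R)).2 = R)
    (h : ∀ n, n % 2 = i % 2 → a n = (σ.move (annotate k (pre a n) Q R)).1) :
    ∃ a' ∈ plays σ, bodyMap (unravelHom T O k).toFun a' = a := by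
  have hpre := pre_annotate (k := k) a Q R
  have hbody : (fun j => (a j, lab k j Q R)) ∈ body (unravelTree T O k) := fun n => by
    change pre (fun j => (a j, lab k j Q R)) n ∈ unravelTree T O k
    rw [hpre]
    exact annotate_mem_iff.2 (hleg n)
  refine ⟨_, ⟨hbody, fun n hn => ?_⟩, TreeHom.bodyMap_eq _ hbody fun n => ?_⟩
  · change (a n, lab k n Q R) = σ.move (pre (fun j => (a j, lab k j Q R)) n)
    rw [hpre]
    refine Prod.ext (h n hn) ?_
    change lab k n Q R = _
    have hl := (legal_of_append (σ.legal _ (annotate_mem_iff.2 (hleg n)) (by simpa using hn))).1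
    rw [length_pre] at hl
    by_cases h1 : n = k
    · subst h1
      rw [lab_self, hQ hn]
    · by_cases h2 : n = k + 1
      · subst h2
        rw [lab_succ, hR hn]
      · rw [hl, lab_of_ne h1 h2, lab_of_ne h1 h2]
  · rw [hpre]
    exact map_fst_annotate _ _ _

theorem lift_of_cone [Inhabited A] {i : ℕ} (σ : Strategy (unravelTree T O k) i) {a : ℕ → A} (ha : a ∈ body T)
    {Q : Set (List A)} (hQs : Quasi 1 T (pre a (k + 1)) Q) {m : ℕ} (hm : k + 2 ≤ m)
    (hmQ : pre a m ∈ Q) (hmO : pre a m ∈ O)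
    (hQ : k % 2 = i % 2 → (σ.move (annotate k (pre a k) Q (cone T (pre a m)))).2 = Q)
    (hR : (k + 1) % 2 = i % 2 →
      (σ.move (annotate k (pre a (k + 1)) Q (cone T (pre a m)))).2 = cone T (pre a m))
    (h : ∀ n, n % 2 = i % 2 → n < k + 2 ∨ m ≤ n →
      Legal T O k (pre a n) Q (cone T (pre a m)) →
      a n = (σ.move (annotate k (pre a n) Q (cone T (pre a m)))).1) :
    ∃ a' ∈ plays σ, bodyMap (unravelHom T O k).toFun a' = a := by
  have hleg : ∀ n, Legal T O k (pre a n) Q (cone T (pre a m)) := fun n =>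
    legal_pre ha hQs (Or.inl ⟨_, hmQ, hmO, pre_prefix_pre a hm, rfl⟩)
      fun _ => pre_mem_cone ha m n
  refine lift_of_legal σ hleg hQ hR fun n hn => ?_
  by_cases hnm : n < k + 2 ∨ m ≤ n
  · exact h n hn hnm (hleg n)
  push Not at hnm
  have hl := (legal_of_append (σ.legal _ (annotate_mem_iff.2 (hleg n)) (by simpa using hn))).2
  have hmem := hl.memR (by simp; omega)
  rw [if_neg (by simp; omega)] at hmem
  set b := (σ.move (annotate k (pre a n) Q (cone T (pre a m)))).1
  have hpre : pre a n ++ [b] = pre a (n + 1) := by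
    rcases hmem.2 with h1 | h1
    · exact eq_of_prefix_of_prefix h1 (pre_prefix_pre a hnm.2) (by simp)
    · exact (eq_of_prefix_of_prefix ((pre_prefix_pre a hnm.2).trans h1) List.prefix_rfl
        (by simp)).symm
  rw [pre_succ] at hpre
  simpa using hpre.symm

theorem not_exists_prefix_pre {a : ℕ → A} {b : ℕ} {W : Set (List A)} {n : ℕ}
    (h : ∀ m, b ≤ m → m ≤ n → pre a m ∉ W) :
    ¬∃ y, y <+: pre a n ∧ b ≤ y.length ∧ y ∈ W := by
  rintro ⟨y, hy, hb, hW⟩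
  rw [eq_pre_of_prefix hy] at hW
  exact h _ hb (by simpa using hy.length_le) hW

theorem not_exists_firstIn_pre {a : ℕ → A} {b : ℕ} {W : Set (List A)} {n : ℕ}
    (h : ∀ m, b ≤ m → m ≤ n → pre a m ∉ W) : ¬∃ y, y <+: pre a n ∧ FirstIn b W y :=
  fun ⟨y, hy, hf⟩ => not_exists_prefix_pre h ⟨y, hy, hf.1, hf.2.1⟩

theorem epsilon_firstIn {b : ℕ} {W : Set (List A)} {u p : List A} (hu : u <+: p)
    (hf : FirstIn b W u) : (Classical.epsilon fun u => u <+: p ∧ FirstIn b W u) = u := by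
  have h := Classical.epsilon_spec (p := fun u => u <+: p ∧ FirstIn b W u) ⟨u, hu, hf⟩
  exact h.2.eq hf h.1 hu

section Guard

variable [Inhabited A]

open Classical in
/-- The moves of a strategy, made constant outside of the tree. -/
noncomputable def Strategy.guard {S : Set (List A)} {i : ℕ} (σ : Strategy S i) (x : List A) : A :=
  if x ∈ S then σ.move x else default

theorem Strategy.guard_eq {S : Set (List A)} {i : ℕ} (σ : Strategy S i) {x : List A} (h : x ∈ S) :
    σ.guard x = σ.move x := if_pos h

theorem Strategy.guard_congr {S : Set (List A)} {i n : ℕ} {σ σ' : Strategy S i}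
    (h : ∀ x ∈ S, x.length ≤ n → σ.move x = σ'.move x) {x : List A} (hx : x.length ≤ n) :
    σ.guard x = σ'.guard x := by
  by_cases hS : x ∈ S
  · rw [σ.guard_eq hS, σ'.guard_eq hS, h x hS hx]
  · simp [Strategy.guard, hS]

end Guard

variable [Inhabited A]

open Classical in
/-- The moves of the first player in `T` obtained from moves `g` in the unraveled game, once the
quasistrategy `Q` has been proposed. -/
noncomputable def movesIAux (T O : Set (List A)) (k : ℕ)
    (g : List (A × Set (List A)) → A × Set (List A)) (Q : Set (List A)) (p : List A) : A :=
  if ∃ u, u <+: p ∧ FirstIn (k + 2) (O ∩ Q) u then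
    (g (annotate k p Q
      (cone T (Classical.epsilon fun u => u <+: p ∧ FirstIn (k + 2) (O ∩ Q) u)))).1
  else if ∃ y, y <+: p ∧ k + 2 ≤ y.length ∧ y ∈ Wins 0 Q (O ∩ Q) then
    attackMove 0 Q (O ∩ Q) (k + 2) p
  else (g (annotate k p Q (Safe 0 Q (O ∩ Q) (p.take (k + 2))))).1

/-- The moves of the first player in `T` obtained from moves `g` in the unraveled game. -/
noncomputable def movesI (T O : Set (List A)) (k : ℕ)
    (g : List (A × Set (List A)) → A × Set (List A)) (p : List A) : A :=
  if p.length < k + 1 then (g (annotate k p ∅ ∅)).1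
  else movesIAux T O k g (g (annotate k (p.take k) ∅ ∅)).2 p

/-- The quasistrategy `Q` makes the second player point at `u`. -/
def PointsAt (T O : Set (List A)) (k : ℕ) (g : List (A × Set (List A)) → A × Set (List A))
    (r u : List A) (Q : Set (List A)) : Prop :=
  Quasi 1 T r Q ∧ u ∈ Q ∧ u ∈ O ∧ r ++ [(g (annotate k r Q ∅)).1] <+: u ∧
    (g (annotate k r Q ∅)).2 = cone T u

/-- The positions the second player may be made to point at. -/
def targets (T O : Set (List A)) (k : ℕ) (g : List (A × Set (List A)) → A × Set (List A))
    (r : List A) : Set (List A) := {u | ∃ Q, PointsAt T O k g r u Q}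

open Classical in
/-- The moves of the second player in `T` obtained from moves `g` in the unraveled game, after the
first player has reached `r`, where `U` is the set of targets. -/
noncomputable def movesIIAux (T O : Set (List A)) (k : ℕ)
    (g : List (A × Set (List A)) → A × Set (List A)) (r : List A) (U : Set (List A))
    (p : List A) : A :=
  if ∃ u, u <+: p ∧ FirstIn (k + 1) U u then
    (g (annotate k p (Classical.epsilon
      (PointsAt T O k g r (Classical.epsilon fun u => u <+: p ∧ FirstIn (k + 1) U u)))
      (cone T (Classical.epsilon fun u => u <+: p ∧ FirstIn (k + 1) U u)))).1
  else if ∃ y, y <+: p ∧ k + 1 ≤ y.length ∧ y ∈ Wins 1 T U then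
    attackMove 1 T U (k + 1) p
  else (g (annotate k p (Safe 1 T U r) (g (annotate k r (Safe 1 T U r) ∅)).2)).1

/-- The moves of the second player in `T` obtained from moves `g` in the unraveled game. -/
noncomputable def movesII (T O : Set (List A)) (k : ℕ)
    (g : List (A × Set (List A)) → A × Set (List A)) (p : List A) : A :=
  if p.length < k + 1 then (g (annotate k p ∅ ∅)).1
  else movesIIAux T O k g (p.take (k + 1)) (targets T O k g (p.take (k + 1))) p

theorem movesI_congr {g g' : List (A × Set (List A)) → A × Set (List A)} {p : List A}
    (h : ∀ x, x.length ≤ p.length → g x = g' x) : movesI T O k g p = movesI T O k g' p := by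
  have h1 : ∀ Q R, g (annotate k p Q R) = g' (annotate k p Q R) := fun Q R => h _ (by simp)
  have h2 : ∀ Q R, g (annotate k (p.take k) Q R) = g' (annotate k (p.take k) Q R) :=
    fun Q R => h _ (by simp)
  rw [movesI, movesI, h1, h2]
  simp only [movesIAux, h1]

theorem movesII_congr {g g' : List (A × Set (List A)) → A × Set (List A)} {p : List A}
    (h : ∀ x, x.length ≤ p.length → g x = g' x) : movesII T O k g p = movesII T O k g' p := by
  have h1 : ∀ Q R, g (annotate k p Q R) = g' (annotate k p Q R) := fun Q R => h _ (by simp)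
  have h2 : ∀ Q R, g (annotate k (p.take (k + 1)) Q R) = g' (annotate k (p.take (k + 1)) Q R) :=
    fun Q R => h _ (by simp)
  have h3 : PointsAt T O k g (p.take (k + 1)) = PointsAt T O k g' (p.take (k + 1)) := by
    funext u Q
    simp only [PointsAt, h2]
  have h4 : targets T O k g (p.take (k + 1)) = targets T O k g' (p.take (k + 1)) := by
    simp only [targets, h3]
  rw [movesII, movesII, h1, h4]
  simp only [movesIIAux, h1, h2, h3]

theorem movesI_lift (hk : k % 2 = 0) (hp : IsPruned T) {i : ℕ} (hi : i % 2 = 0)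
    (σ : Strategy (unravelTree T O k) i) {a : ℕ → A}
    (ha : a ∈ plays (Strategy.ofMoves hp i (movesI T O k σ.guard))) :
    ∃ a' ∈ plays σ, bodyMap (unravelHom T O k).toFun a' = a := by
  have hmove : ∀ n, n % 2 = 0 → ∀ b, movesI T O k σ.guard (pre a n) = b → pre a n ++ [b] ∈ T →
      a n = b := by
    rintro n hn _ rfl hT
    rw [Strategy.eq_of_plays ha (hn.trans hi.symm), Strategy.ofMoves_move hp i hT]
  have hσ : ∀ {n : ℕ} {Q R}, n % 2 = 0 → Legal T O k (pre a n) Q R →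
      σ.guard (annotate k (pre a n) Q R) = σ.move (annotate k (pre a n) Q R) ∧
      annotate k (pre a n) Q R ++ [σ.move (annotate k (pre a n) Q R)] ∈ unravelTree T O k :=
    fun hn hL => ⟨σ.guard_eq (annotate_mem_iff.2 hL),
      σ.legal _ (annotate_mem_iff.2 hL) (by simpa using hn.trans hi.symm)⟩
  have hshort : ∀ n, n ≤ k → n % 2 = 0 → ∀ Q R,
      a n = (σ.move (annotate k (pre a n) Q R)).1 := fun n hnk hn Q R => by
    obtain ⟨h1, h2⟩ := hσ hn (legal_of_length_le (pre_mem ha.1 n) (by simpa using hnk) ∅ ∅)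
    rw [annotate_congr (Q' := ∅) (R' := ∅) (fun h => by rw [length_pre] at h; omega)
      (fun h => by rw [length_pre] at h; omega)]
    refine hmove n hn _ ?_ (legal_of_append h2).2.mem
    rw [movesI, if_pos (by simpa using Nat.lt_succ_of_le hnk), h1]
  obtain ⟨hg, hleg⟩ := hσ hk (legal_of_length_le (pre_mem ha.1 k) (by simp) ∅ ∅)
  have hLk := (legal_of_append hleg).2
  obtain ⟨Q, hQdef⟩ : ∃ Q, Q = (σ.move (annotate k (pre a k) ∅ ∅)).2 := ⟨_, rfl⟩
  rw [← hshort k le_rfl hk ∅ ∅, ← pre_succ, ← hQdef, if_pos (by simp)] at hLk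
  have hQs : Quasi 1 T (pre a (k + 1)) Q := by
    simpa [take_pre] using hLk.left (by simp)
  have hQk : ∀ R, (σ.move (annotate k (pre a k) Q R)).2 = Q := fun R => by
    rw [annotate_congr (Q' := ∅) (R' := ∅) (by simp) (by simp), ← hQdef]
  have htake : ∀ n, k ≤ n → (σ.guard (annotate k ((pre a n).take k) ∅ ∅)).2 = Q := fun n hn => by
    rw [take_pre a hn, hg, ← hQdef]
  have hopp : ∀ n, n % 2 ≠ 0 → pre a n ∈ Q → pre a (n + 1) ∈ Q := fun n hn hmem => by
    rw [pre_succ]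
    refine hQs.opp _ hmem (by rw [length_pre]; omega) _ ?_
    rw [← pre_succ]
    exact pre_mem ha.1 _
  by_cases hhit : ∃ n, k + 2 ≤ n ∧ pre a n ∈ O ∩ Q
  · obtain ⟨n, hn, hmem⟩ := hhit
    obtain ⟨u, hu, huf⟩ := exists_firstIn (b := k + 2) (by simpa using hn) hmem
    obtain ⟨m, rfl⟩ : ∃ m, u = pre a m := ⟨_, eq_pre_of_prefix hu⟩
    have hkm : k + 2 ≤ m := by simpa using huf.1
    refine lift_of_cone σ ha.1 hQs hkm huf.2.1.2 huf.2.1.1 (fun _ => hQk _)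
      (fun h => by omega) fun n hn hnm hL => ?_
    rw [hi] at hn
    rcases hnm with hnk | hnm
    · exact hshort n (by omega) hn _ _
    · obtain ⟨h1, h2⟩ := hσ hn hL
      have hup := pre_prefix_pre a hnm
      refine hmove n hn _ ?_ (legal_of_append h2).2.mem
      rw [movesI, if_neg (by rw [length_pre]; omega)]
      rw [htake n (by omega), movesIAux, if_pos ⟨_, hup, huf⟩, epsilon_firstIn hup huf, h1]
  · push Not at hhit
    have hW : ∀ n, k + 2 ≤ n → pre a n ∉ Wins 0 Q (O ∩ Q) := by
      intro n hn hw
      refine (exists_pre_mem_of_attack (fun n _ => hopp n)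
        (fun n hn h0 _ hex hE => ?_) ⟨n, hn, hw⟩).elim fun m hm => hhit m hm.1 hm.2
      · obtain ⟨m, hm, hmn, hmW⟩ := hex
        refine hmove n h0 _ ?_ (hQs.sub _ hE).2
        rw [movesI, if_neg (by rw [length_pre]; omega)]
        rw [htake n (by omega), movesIAux, if_neg (not_exists_firstIn_pre fun m hm _ => hhit m hm),
          if_pos ⟨_, pre_prefix_pre a hmn, by simpa using hm, hmW⟩]
    have hq : pre a (k + 2) ∈ Q := hopp (k + 1) (by omega) hQs.mem
    have hqs := quasi_safe hq (hW _ le_rfl)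
    have hopt : Option₂ T O Q (Safe 0 Q (O ∩ Q) (pre a (k + 2))) (pre a (k + 2)) :=
      Or.inr ⟨hqs, fun x hx hxO => notMem_of_mem_safe hx ⟨hxO, (hqs.sub x hx).2⟩⟩
    have hmv : ∀ n, k + 2 ≤ n → n % 2 = 0 →
        Legal T O k (pre a n) Q (Safe 0 Q (O ∩ Q) (pre a (k + 2))) →
        a n = (σ.move (annotate k (pre a n) Q (Safe 0 Q (O ∩ Q) (pre a (k + 2))))).1 := by
      intro n hn h0 hL
      obtain ⟨h1, h2⟩ := hσ h0 hL
      refine hmove n h0 _ ?_ (legal_of_append h2).2.mem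
      rw [movesI, if_neg (by rw [length_pre]; omega)]
      rw [htake n (by omega), movesIAux, if_neg (not_exists_firstIn_pre fun m hm _ => hhit m hm),
        if_neg (not_exists_prefix_pre fun m hm _ => hW m hm), take_pre a hn, h1]
    have hR : ∀ n, k + 2 ≤ n → pre a n ∈ Safe 0 Q (O ∩ Q) (pre a (k + 2)) := by
      intro n hn
      induction n, hn using Nat.le_induction with
      | base => exact hqs.mem
      | succ n hn ih =>
        by_cases h0 : n % 2 = 0
        · have hL := legal_pre ha.1 hQs hopt fun _ => ih
          obtain ⟨h1, h2⟩ := hσ h0 hL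
          have h3 := (legal_of_append h2).2.memR (by simp; omega)
          rwa [if_neg (by rw [length_pre]; omega), ← hmv n hn h0 hL, ← pre_succ] at h3
        · have h1 := hopp n h0 (hqs.sub _ ih).2
          have h2 := hW (n + 1) (by omega)
          rw [pre_succ a n] at h1 h2 ⊢
          exact safe_append ih h1 h2
    have hL : ∀ n, Legal T O k (pre a n) Q (Safe 0 Q (O ∩ Q) (pre a (k + 2))) := fun n =>
      legal_pre ha.1 hQs hopt (hR n)
    refine lift_of_legal σ hL (fun _ => hQk _) (fun h => by omega) fun n hn => ?_
    rw [hi] at hn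
    by_cases hnk : n ≤ k
    · exact hshort n hnk hn _ _
    · exact hmv n (by omega) hn (hL n)

theorem movesII_lift (hk : k % 2 = 0) (hp : IsPruned T) {i : ℕ} (hi : i % 2 = 1)
    (σ : Strategy (unravelTree T O k) i) {a : ℕ → A}
    (ha : a ∈ plays (Strategy.ofMoves hp i (movesII T O k σ.guard))) :
    ∃ a' ∈ plays σ, bodyMap (unravelHom T O k).toFun a' = a := by
  have hmove : ∀ n, n % 2 = 1 → ∀ b, movesII T O k σ.guard (pre a n) = b → pre a n ++ [b] ∈ T →
      a n = b := by
    rintro n hn _ rfl hT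
    rw [Strategy.eq_of_plays ha (hn.trans hi.symm), Strategy.ofMoves_move hp i hT]
  have hσ : ∀ {n : ℕ} {Q R}, n % 2 = 1 → Legal T O k (pre a n) Q R →
      σ.guard (annotate k (pre a n) Q R) = σ.move (annotate k (pre a n) Q R) ∧
      annotate k (pre a n) Q R ++ [σ.move (annotate k (pre a n) Q R)] ∈ unravelTree T O k :=
    fun hn hL => ⟨σ.guard_eq (annotate_mem_iff.2 hL),
      σ.legal _ (annotate_mem_iff.2 hL) (by simpa using hn.trans hi.symm)⟩
  have hshort : ∀ n, n ≤ k → n % 2 = 1 → ∀ Q R,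
      a n = (σ.move (annotate k (pre a n) Q R)).1 := fun n hnk hn Q R => by
    obtain ⟨h1, h2⟩ := hσ hn (legal_of_length_le (pre_mem ha.1 n) (by simpa using hnk) ∅ ∅)
    rw [annotate_congr (Q' := ∅) (R' := ∅) (fun h => by rw [length_pre] at h; omega)
      (fun h => by rw [length_pre] at h; omega)]
    refine hmove n hn _ ?_ (legal_of_append h2).2.mem
    rw [movesII, if_pos (by simpa using Nat.lt_succ_of_le hnk), h1]
  have hodd : (k + 1) % 2 = 1 := by omega
  have hstart : ∀ {Q : Set (List A)}, Quasi 1 T (pre a (k + 1)) Q →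
      Legal T O k (pre a (k + 1)) Q ∅ := fun hQ =>
    ⟨pre_mem ha.1 _, fun _ => by rwa [take_pre a le_rfl], fun h => by simp at h,
      fun h => by simp at h⟩
  have hstartR : ∀ Q R, annotate k (pre a (k + 1)) Q R = annotate k (pre a (k + 1)) Q ∅ :=
    fun Q R => annotate_congr (fun _ => rfl) (by simp)
  obtain ⟨U, hU⟩ : ∃ U, U = targets T O k σ.guard (pre a (k + 1)) := ⟨_, rfl⟩
  have htarget : ∀ {u Q}, PointsAt T O k σ.guard (pre a (k + 1)) u Q →
      pre a (k + 1) ++ [(σ.move (annotate k (pre a (k + 1)) Q ∅)).1] <+: u ∧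
        (σ.move (annotate k (pre a (k + 1)) Q ∅)).2 = cone T u := by
    rintro u Q ⟨h1, -, -, h2, h3⟩
    rw [(hσ hodd (hstart h1)).1] at h2 h3
    exact ⟨h2, h3⟩
  by_cases hhit : ∃ n, k + 1 ≤ n ∧ pre a n ∈ U
  · obtain ⟨n, hn, hmem⟩ := hhit
    obtain ⟨u, hu, huf⟩ := exists_firstIn (b := k + 1) (by simpa using hn) hmem
    obtain ⟨m, rfl⟩ : ∃ m, u = pre a m := ⟨_, eq_pre_of_prefix hu⟩
    have hex := huf.2.1
    rw [hU] at hex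
    obtain ⟨Q, hQdef⟩ : ∃ Q, Q = Classical.epsilon
      (PointsAt T O k σ.guard (pre a (k + 1)) (pre a m)) := ⟨_, rfl⟩
    have hpt : PointsAt T O k σ.guard (pre a (k + 1)) (pre a m) Q :=
      hQdef ▸ Classical.epsilon_spec hex
    obtain ⟨h1, h2⟩ := htarget hpt
    have hkm : k + 2 ≤ m := by
      have := h1.length_le
      simp only [List.length_append, length_pre, List.length_singleton] at this
      omega
    refine lift_of_cone σ ha.1 hpt.1 hkm hpt.2.1 hpt.2.2.1 (fun h => by omega)
      (fun _ => by rw [hstartR]; exact h2) fun n hn hnm hL => ?_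
    rw [hi] at hn
    rcases hnm with hnk | hnm
    · rcases (Nat.lt_succ_iff.1 hnk).eq_or_lt with rfl | hnk
      · rw [hstartR]
        have h3 := eq_of_prefix_of_prefix h1 (pre_prefix_pre a hkm) (by simp)
        rw [pre_succ a (k + 1)] at h3
        simpa using h3.symm
      · exact hshort n (by omega) hn _ _
    · obtain ⟨h3, h4⟩ := hσ hn hL
      have hup := pre_prefix_pre a hnm
      refine hmove n hn _ ?_ (legal_of_append h4).2.mem
      rw [movesII, if_neg (by rw [length_pre]; omega)]
      rw [take_pre a (show k + 1 ≤ n by omega), ← hU, movesIIAux, if_pos ⟨_, hup, huf⟩, epsilon_firstIn hup huf, ← hQdef, h3]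
  · push Not at hhit
    have htk : ∀ n, k + 1 ≤ n → (pre a n).take (k + 1) = pre a (k + 1) := fun n => take_pre a
    have hW : ∀ n, k + 1 ≤ n → pre a n ∉ Wins 1 T U := by
      intro n hn hw
      refine (exists_pre_mem_of_attack (fun n _ _ _ => pre_mem ha.1 (n + 1))
        (fun n hn h0 _ hex hE => ?_) ⟨n, hn, hw⟩).elim fun m hm => hhit m hm.1 hm.2
      · obtain ⟨m, hm, hmn, hmW⟩ := hex
        refine hmove n h0 _ ?_ hE
        rw [movesII, if_neg (by rw [length_pre]; omega)]
        rw [htk n hn, ← hU, movesIIAux, if_neg (not_exists_firstIn_pre fun m hm _ => hhit m hm),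
          if_pos ⟨_, pre_prefix_pre a hmn, by simpa using hm, hmW⟩]
    obtain ⟨Q, hQdef⟩ : ∃ Q, Q = Safe 1 T U (pre a (k + 1)) := ⟨_, rfl⟩
    have hQs : Quasi 1 T (pre a (k + 1)) Q :=
      hQdef ▸ quasi_safe (pre_mem ha.1 _) (hW _ le_rfl)
    have hQmem : ∀ n, k + 1 ≤ n → pre a n ∈ Q := by
      intro n hn
      induction n, hn using Nat.le_induction with
      | base => exact hQs.mem
      | succ n hn ih =>
        have h1 := pre_mem ha.1 (n + 1)
        have h2 := hW (n + 1) (by omega)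
        rw [pre_succ a n] at h1 h2 ⊢
        rw [hQdef] at ih ⊢
        exact safe_append ih h1 h2
    obtain ⟨hg, hleg⟩ := hσ hodd (hstart hQs)
    obtain ⟨R, hRdef⟩ : ∃ R, R = (σ.move (annotate k (pre a (k + 1)) Q ∅)).2 := ⟨_, rfl⟩
    have hmv : ∀ n, k + 1 ≤ n → n % 2 = 1 → Legal T O k (pre a n) Q R →
        a n = (σ.move (annotate k (pre a n) Q R)).1 := by
      intro n hn h0 hL
      obtain ⟨h1, h2⟩ := hσ h0 hL
      refine hmove n h0 _ ?_ (legal_of_append h2).2.mem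
      rw [movesII, if_neg (by rw [length_pre]; omega)]
      rw [htk n hn, ← hU, movesIIAux, if_neg (not_exists_firstIn_pre fun m hm _ => hhit m hm),
        if_neg (not_exists_prefix_pre fun m hm _ => hW m hm), ← hQdef, hg, ← hRdef, h1]
    have hLk : Legal T O k (pre a (k + 1)) Q R :=
      (hstart hQs).congr (fun _ => rfl) (fun h => by simp at h)
    have hfirst := hmv (k + 1) le_rfl hodd hLk
    rw [hstartR] at hfirst
    have hLk2 := (legal_of_append hleg).2
    rw [← hfirst, ← hRdef, ← pre_succ, if_neg (by simp), if_pos (by simp)] at hLk2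
    have hopt : Option₂ T O Q R (pre a (k + 2)) := by
      simpa [take_pre] using hLk2.right (by simp)
    have hRq : Quasi 0 Q (pre a (k + 2)) R := by
      rcases hopt with ⟨u, huQ, huO, hqu, hRu⟩ | h
      · refine absurd ⟨Q, hQs, huQ, huO, ?_, ?_⟩ (?_ : u ∉ targets T O k σ.guard (pre a (k + 1)))
        · rw [← hU]
          exact notMem_of_mem_safe (hQdef ▸ huQ)
        · rwa [hg, ← hfirst, ← pre_succ]
        · rw [hg, ← hRdef, hRu]
      · exact h.1
    have hR : ∀ n, k + 2 ≤ n → pre a n ∈ R := by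
      intro n hn
      induction n, hn using Nat.le_induction with
      | base => exact hRq.mem
      | succ n hn ih =>
        by_cases h0 : n % 2 = 1
        · have hL := legal_pre ha.1 hQs hopt fun _ => ih
          obtain ⟨h1, h2⟩ := hσ h0 hL
          have h3 := (legal_of_append h2).2.memR (by simp; omega)
          rwa [if_neg (by rw [length_pre]; omega), ← hmv n (by omega) h0 hL, ← pre_succ] at h3
        · rw [pre_succ]
          refine hRq.opp _ ih (by rw [length_pre]; omega) _ ?_
          rw [← pre_succ]
          exact hQmem _ (by omega)
    have hL : ∀ n, Legal T O k (pre a n) Q R := fun n => legal_pre ha.1 hQs hopt (hR n)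
    refine lift_of_legal σ hL (fun h => by omega) (fun _ => by rw [hstartR, ← hRdef])
      fun n hn => ?_
    rw [hi] at hn
    by_cases hnk : n ≤ k
    · exact hshort n hnk hn _ _
    · exact hmv n (by omega) hn (hL n)

/-- The covering of `T` by the unraveled game. -/
noncomputable def unravelCovering (O : Set (List A)) (hp : IsPruned T) (hk : k % 2 = 0) :
    Covering (unravelTree T O k) T where
  π := unravelHom T O k
  φ i σ := Strategy.ofMoves hp i
    (if i % 2 = 0 then movesI T O k σ.guard else movesII T O k σ.guard)
  agree i n σ σ' h x _ hxn := by
    refine Strategy.ofMoves_congr hp i ?_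
    have hg : ∀ y, y.length ≤ x.length → σ.guard y = σ'.guard y := fun y hy =>
      Strategy.guard_congr h (hy.trans hxn)
    split_ifs
    · exact movesI_congr hg
    · exact movesII_congr hg
  lift i σ a ha := by
    by_cases hi : i % 2 = 0
    · rw [if_pos hi] at ha
      exact movesI_lift hk hp hi σ ha
    · rw [if_neg hi] at ha
      exact movesII_lift hk hp (by omega) σ ha

theorem isFixing_unravelCovering (O : Set (List A)) (hp : IsPruned T) (hk : k % 2 = 0) :
    IsFixing k (unravelCovering (T := T) O hp hk) := by
  refine isFixing_of_bijOn ?_ ?_ ?_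
  · rintro _ ⟨p, Q, R, rfl, hL⟩ _ ⟨p', Q', R', rfl, hL'⟩ hl h
    change List.map _ _ = List.map _ _ at h
    rw [map_fst_annotate, map_fst_annotate] at h
    subst h
    rw [length_annotate] at hl
    exact annotate_congr (fun h => by omega) (fun h => by omega)
  · intro p hpT hl
    exact ⟨annotate k p ∅ ∅, annotate_mem_iff.2 (legal_of_length_le hpT hl _ _),
      map_fst_annotate _ _ _⟩
  · rintro i σ _ ⟨p, Q, R, rfl, hL⟩ hl hi
    rw [annotate_congr (Q' := ∅) (R' := ∅) (fun h => by rw [length_annotate] at hl; omega)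
      (fun h => by rw [length_annotate] at hl; omega)]
    rw [length_annotate] at hl hi
    have hmem := annotate_mem_iff.2 (legal_of_length_le (O := O) hL.mem hl.le ∅ ∅)
    have hleg := σ.legal _ hmem (by simpa using hi)
    have hmoves : (if i % 2 = 0 then movesI T O k σ.guard else movesII T O k σ.guard) p =
        (σ.move (annotate k p ∅ ∅)).1 := by
      rw [← σ.guard_eq hmem]
      split_ifs
      · rw [movesI, if_pos (by omega)]
      · rw [movesII, if_pos (by omega)]
    change List.map _ _ = List.map _ _ ++ [(Strategy.ofMoves hp i _).move (List.map _ _)]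
    rw [List.map_append, map_fst_annotate, Strategy.ofMoves_move, hmoves]
    · rfl
    · rw [hmoves]
      exact (legal_of_append hleg).2.mem

theorem unravelable_of_isOpen (hT : IsTree T) (hp : IsPruned T) (hne : T.Nonempty)
    {P : Set (ℕ → A)} (hP : @IsOpen _ (bodyTop T) {a : {a // a ∈ body T} | a.1 ∈ P}) :
    Unravelable T P := by
  intro l
  set O : Set (List A) := {x | ∀ a ∈ body T, x = pre a x.length → a ∈ P} with hO
  have hPO : ∀ a ∈ body T, a ∈ P ↔ ∃ n, 2 * l + 2 ≤ n ∧ pre a n ∈ O := by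
    refine fun a ha => ⟨fun h => ?_, ?_⟩
    · obtain ⟨n, hn⟩ := isOpen_bodyTop_iff.1 hP ⟨a, ha⟩ h
      refine ⟨max n (2 * l + 2), le_max_right _ _, fun b hb hab => hn ⟨b, hb⟩ ?_⟩
      rw [length_pre] at hab
      rw [← take_pre b (le_max_left n (2 * l + 2)), ← hab, take_pre a (le_max_left _ _)]
    · rintro ⟨n, -, hn⟩
      exact hn a ha (by simp)
  have hk : (2 * l) % 2 = 0 := by omega
  refine ⟨A × Set (List A), unravelTree T O (2 * l), unravelCovering O hp hk,
    isTree_unravelTree hT, isPruned_unravelTree hT hp hk, nonempty_unravelTree hT hne,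
    (isFixing_unravelCovering O hp hk).mono (by omega), ?_⟩
  have key : ∀ a' : {a // a ∈ body (unravelTree T O (2 * l))},
      bodyMap (unravelHom T O (2 * l)).toFun a'.1 ∈ P ↔ ∃ x ∈ (a'.1 (2 * l + 1)).2, x ∈ O := by
    rintro ⟨a', ha'⟩
    set a := bodyMap (unravelHom T O (2 * l)).toFun a' with hadef
    have ha : a ∈ body T := (unravelHom T O (2 * l)).bodyMap_mem ha'
    have hlegal : ∀ n, 2 * l + 2 ≤ n → ∃ Q, Legal T O (2 * l) (pre a n) Q
        (a' (2 * l + 1)).2 := by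
      intro n hn
      obtain ⟨p, Q, R, he, hL⟩ := pre_mem ha' n
      have hp' : p = pre a n := by
        rw [hadef, ← (unravelHom T O (2 * l)).toFun_pre ha', he]
        exact (map_fst_annotate p Q R).symm
      subst hp'
      have h1 : pre a' (2 * l + 1) ++ [a' (2 * l + 1)] <+: annotate (2 * l) (pre a n) Q R := by
        rw [← pre_succ, ← he]
        exact pre_prefix_pre a' hn
      have h2 : annotate (2 * l) (pre a (2 * l + 1)) Q R ++ [(a (2 * l + 1), R)] <+:
          annotate (2 * l) (pre a n) Q R := by
        have := annotate_append (k := 2 * l) (pre a (2 * l + 1)) (a (2 * l + 1)) Q R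
        rw [length_pre, lab_succ] at this
        rw [← this, ← pre_succ, ← pre_annotate, ← pre_annotate]
        exact pre_prefix_pre _ hn
      have h3 := (List.append_inj' (eq_of_prefix_of_prefix h1 h2 (by simp)) rfl).2
      have h4 : a' (2 * l + 1) = (a (2 * l + 1), R) := (List.cons.inj h3).1
      rw [h4]
      exact ⟨Q, hL⟩
    rw [hPO a ha]
    constructor
    · rintro ⟨n, hn, hnO⟩
      obtain ⟨Q, hL⟩ := hlegal n hn
      exact ⟨_, hL.memR (by rw [length_pre]; omega), hnO⟩
    · rintro ⟨x, hxR, hxO⟩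
      obtain ⟨Q, hL⟩ := hlegal _ le_rfl
      rcases hL.right (by simp) with ⟨u, -, huO, hqu, hRu⟩ | ⟨-, hR⟩
      · have hn : 2 * l + 2 ≤ u.length := by
          rw [take_pre a le_rfl] at hqu
          simpa using hqu.length_le
        refine ⟨u.length, hn, ?_⟩
        obtain ⟨Q', hL'⟩ := hlegal _ hn
        have hmem := hL'.memR (by rw [length_pre]; omega)
        rw [hRu] at hmem
        have : pre a u.length = u := by
          rcases hmem.2 with h | h
          · exact eq_of_prefix_of_prefix h List.prefix_rfl (by simp)
          · exact (eq_of_prefix_of_prefix h List.prefix_rfl (by simp)).symm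
        rwa [this]
      · exact absurd hxO (hR x hxR)
  refine isClopen_bodyTop_of_determined (2 * l + 2) fun a b hab haP => (key b).2 ?_
  rw [show 2 * l + 2 = (2 * l + 1) + 1 from rfl, pre_succ a.1 (2 * l + 1),
    pre_succ b.1 (2 * l + 1)] at hab
  have h1 : a.1 (2 * l + 1) = b.1 (2 * l + 1) :=
    (List.cons.inj (List.append_inj' hab rfl).2).1
  rw [← h1]
  exact (key a).1 haP

end UnravelStrategies

section SigmaAlgebra

variable {A : Type u} [Inhabited A] {T : Set (List A)} {P P' : Set (ℕ → A)}

theorem Unravelable.congr (h : Unravelable T P) (hPP' : ∀ a ∈ body T, a ∈ P ↔ a ∈ P') :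
    Unravelable T P' := fun k => by
  obtain ⟨B, S, c, h1, h2, h3, h4, h5⟩ := h k
  refine ⟨B, S, c, h1, h2, h3, h4, ?_⟩
  convert h5 using 3 with a
  exact (hPP' _ (c.π.bodyMap_mem a.2)).symm

theorem UnivUnravelable.congr (h : UnivUnravelable T P) (hPP' : ∀ a ∈ body T, a ∈ P ↔ a ∈ P') :
    UnivUnravelable T P' := fun B _ S c h1 h2 h3 =>
  (h B _ S c h1 h2 h3).congr fun _ ha => hPP' _ (c.π.bodyMap_mem ha)

theorem UnivUnravelable.compl (h : UnivUnravelable T P) : UnivUnravelable T Pᶜ :=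
  fun B _ S c h1 h2 h3 k => by
    obtain ⟨C, S', d, h4, h5, h6, h7, h8⟩ := h B _ S c h1 h2 h3 k
    exact ⟨C, S', d, h4, h5, h6, h7, @IsClopen.compl _ (bodyTop S') _ h8⟩

theorem univUnravelable_empty (T : Set (List A)) : UnivUnravelable T ∅ :=
  fun B _ S _ h1 h2 h3 k =>
    ⟨B, S, Covering.id S, h1, h2, h3, isFixing_id S k, @isClopen_empty _ (bodyTop S)⟩

theorem UnivUnravelable.comap {B : Type u} [Inhabited B] {S : Set (List B)}
    (h : UnivUnravelable T P) (c : Covering S T) :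
    UnivUnravelable S (bodyMap c.π.toFun ⁻¹' P) := fun C _ S' d h1 h2 h3 =>
  (h C _ S' (c.comp d) h1 h2 h3).congr fun a ha => by
    change bodyMap (c.π.comp d.π).toFun a ∈ P ↔ _
    rw [TreeHom.bodyMap_comp _ _ ha]
    rfl

/-- A nonempty pruned tree together with a covering of `T`. -/
structure Stage (T : Set (List A)) where
  Alph : Type u
  inhabited : Inhabited Alph
  tree : Set (List Alph)
  cov : Covering tree T
  isTree : IsTree tree
  isPruned : IsPruned tree
  nonempty : tree.Nonempty

attribute [instance] Stage.inhabited

theorem UnivUnravelable.exists_stage (h : UnivUnravelable T P) (s : Stage T) (k : ℕ) :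
    ∃ (t : Stage T) (c : Covering t.tree s.tree), t.cov = s.cov.comp c ∧ IsFixing k c ∧
      @IsClopen _ (bodyTop t.tree) {a | bodyMap t.cov.π.toFun a.1 ∈ P} := by
  obtain ⟨B, S, c, h1, h2, h3, h4, h5⟩ := h _ _ s.tree s.cov s.isTree s.isPruned s.nonempty k
  obtain ⟨b⟩ := exists_move h2 h3
  let _ : Inhabited B := ⟨b⟩
  refine ⟨⟨B, ⟨b⟩, S, s.cov.comp c, h1, h2, h3⟩, c, rfl, h4, ?_⟩
  convert h5 using 3 with a
  exact iff_of_eq (congrArg (· ∈ P) (TreeHom.bodyMap_comp s.cov.π c.π a.2))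

theorem exists_stages (hT : IsTree T) (hp : IsPruned T) (hne : T.Nonempty)
    {P : ℕ → Set (ℕ → A)} (h : ∀ n, UnivUnravelable T (P n)) (k : ℕ) :
    ∃ (s : ℕ → Stage T) (c : ∀ n, Covering (s (n + 1)).tree (s n).tree), IsFixing k (s 0).cov ∧
      ∀ n, (s (n + 1)).cov = (s n).cov.comp (c n) ∧ IsFixing (k + n) (c n) ∧
        @IsClopen _ (bodyTop (s (n + 1)).tree)
          {a | bodyMap (s (n + 1)).cov.π.toFun a.1 ∈ P n} := by
  choose next c hc using fun n s => (h n).exists_stage s (k + n)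
  let s : ℕ → Stage T := fun n => n.rec ⟨A, inferInstance, T, Covering.id T, hT, hp, hne⟩ next
  exact ⟨s, fun n => c n (s n), isFixing_id T k, fun n => hc n (s n)⟩

theorem unravelable_iUnion (hT : IsTree T) (hp : IsPruned T) (hne : T.Nonempty)
    {P : ℕ → Set (ℕ → A)} (h : ∀ n, UnivUnravelable T (P n)) : Unravelable T (⋃ n, P n) := by
  intro k
  obtain ⟨s, c, hs0, hs⟩ := exists_stages hT hp hne h k
  have hK : Monotone (k + ·) := fun _ _ h => Nat.add_le_add_left h k
  have hc : ∀ n, IsFixing (k + n) (c n) := fun n => (hs n).2.1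
  have hKn : ∀ n, n ≤ k + n := fun n => Nat.le_add_left n k
  have hSp : ∀ n, IsPruned (s n).tree := fun n => (s n).isPruned
  have hST : ∀ n, IsTree (s n).tree := fun n => (s n).isTree
  let d := (s 0).cov.comp (limCovering hK hc hKn hSp)
  let S : ∀ n, Set (List (s n).Alph) := fun n => (s n).tree
  let E : Set (List (∀ n, (s n).Alph)) := limTree (homs (S := S) c)
  let L : ∀ n, TreeHom E (S n) := limHom (homs (S := S) c)
  have hproj : ∀ n, ∀ a ∈ body E,
      bodyMap (s n).cov.π.toFun (bodyMap (L n).toFun a) = bodyMap d.π.toFun a := by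
    intro n a ha
    induction n with
    | zero => exact (TreeHom.bodyMap_comp _ _ ha).symm
    | succ n ih =>
      rw [← ih, (hs n).1]
      have hmem := (L (n + 1)).bodyMap_mem ha
      refine (TreeHom.bodyMap_comp (s n).cov.π (c n).π hmem).trans (congrArg _ ?_)
      refine (TreeHom.bodyMap_comp (c n).π _ ha).symm.trans
        (TreeHom.bodyMap_eq _ ha fun m => ?_)
      rw [← (L n).toFun_pre ha]
      exact (pre_mem ha m n).2
  have hopen : @IsOpen _ (bodyTop E)
      {a | a.1 ∈ bodyMap d.π.toFun ⁻¹' ⋃ n, P n} := by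
    let := bodyTop (E)
    simp only [Set.preimage_iUnion, Set.mem_iUnion, Set.ofPred_exists]
    refine isOpen_iUnion fun n => ?_
    let := bodyTop (s (n + 1)).tree
    convert (hs n).2.2.isOpen.preimage (continuous_bodyMap (L (n + 1))) using 1
    ext a
    exact iff_of_eq (congrArg (· ∈ P n) (hproj (n + 1) a.1 a.2).symm)
  obtain ⟨B, S', e, h1, h2, h3, h4, h5⟩ := unravelable_of_isOpen (isTree_limTree hST)
    (isPruned_limTree hK hc hKn hST hSp) (nonempty_limTree hST fun n => (s n).nonempty) hopen k
  refine ⟨B, S', d.comp e, h1, h2, h3,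
    (hs0.comp (isFixing_limCovering hK hc hKn hSp)).comp h4, ?_⟩
  convert h5 using 3 with a
  exact iff_of_eq (congrArg (· ∈ ⋃ n, P n) (TreeHom.bodyMap_comp d.π e.π a.2))

theorem univUnravelable_iUnion {P : ℕ → Set (ℕ → A)} (h : ∀ n, UnivUnravelable T (P n)) :
    UnivUnravelable T (⋃ n, P n) := fun _ _ S c h1 h2 h3 => by
  rw [Set.preimage_iUnion]
  exact unravelable_iUnion h1 h2 h3 fun n => (h n).comap c

end SigmaAlgebra

end GS

namespace GS
/-- For a fixed nonempty pruned tree `T`, the sets `P` such that `(T, P)` is universally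
unravelable form a σ-algebra on the body of `T`. -/
theorem univUnravelable_sigmaAlgebra {A : Type u} [Inhabited A] (T : Set (List A))
    (hT : IsTree T) (hpr : IsPruned T) (hne : T.Nonempty) :
    ∃ m : MeasurableSpace {a // a ∈ body T},
      ∀ Q : Set {a // a ∈ body T},
        @MeasurableSet _ m Q ↔ UnivUnravelable T (Subtype.val '' Q) := by
  refine ⟨{
    MeasurableSet' := fun Q => UnivUnravelable T (Subtype.val '' Q)
    measurableSet_empty := ?_
    measurableSet_compl := fun Q hQ => hQ.compl.congr fun a ha => ?_
    measurableSet_iUnion := fun Q hQ => ?_ }, fun Q => Iff.rfl⟩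
  · rw [Set.image_empty]
    exact univUnravelable_empty T
  · simp [ha]
  · rw [Set.image_iUnion]
    exact univUnravelable_iUnion hQ
end GS
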